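/- Let φ ∈ C_b(ℝ^d_0) have support bounded away from 0 and of positive V-capacity. Then the process t ↦ ∫_{ℝ^d_0} φ(z)L(t,dz) is not quasi-continuous as a process, neither on ℝ_+ nor on any interval [0,T], T > 0. -/

import Mathlib

open MeasureTheory Set Filter Topology
open scoped ENNReal NNReal

noncomputable section

/-- Euclidean space `ℝ^d`. -/
abbrev Rd (d : ℕ) : Type := EuclideanSpace ℝ (Fin d)

/-- Build a point of `ℝ^m` from its coordinates. -/
def toRd {m : ℕ} (x : Fin m → ℝ) : Rd m := (WithLp.equiv 2 (Fin m → ℝ)).symm x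

/-- Concatenation `ℝ^m × ℝ^n → ℝ^(m+n)`. -/
def appendRd {m n : ℕ} (a : Rd m) (b : Rd n) : Rd (m + n) :=
  toRd (Fin.append (fun i => a i) (fun j => b j))

/-- First block of `ℝ^(m+n)`. -/
def fstRd {m n : ℕ} (z : Rd (m + n)) : Rd m := toRd fun i => z (Fin.castAdd n i)

/-- Second block of `ℝ^(m+n)`. -/
def sndRd {m n : ℕ} (z : Rd (m + n)) : Rd n := toRd fun j => z (Fin.natAdd m j)

/-- A function `ℝ → E` which is càdlàg on `[0,∞)`: right-continuous with left limits. -/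
def CadlagOn {E : Type*} [TopologicalSpace E] (x : ℝ → E) : Prop :=
  (∀ t : ℝ, 0 ≤ t → ContinuousWithinAt x (Ici t) t) ∧
    ∀ t : ℝ, 0 < t → ∃ L, Tendsto x (𝓝[<] t) (𝓝 L)

/-- The Skorohod path space `𝔻(ℝ₊, ℝ^d)` of càdlàg paths on `[0,∞)` (extended by `0` on the
negative half-line).  The Skorohod topology on it is carried around as an instance parameter
`[TopologicalSpace (CadPath d)]`, and its Borel σ-algebra as `[MeasurableSpace (CadPath d)]`
together with `[BorelSpace (CadPath d)]`. -/
structure CadPath (d : ℕ) : Type where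
  toFun : ℝ → Rd d
  cadlag' : CadlagOn toFun
  zero_of_neg : ∀ t : ℝ, t < 0 → toFun t = 0

/-- The jump `Δω_t = ω_t - ω_{t-}` of a càdlàg path at time `t`. -/
def CadPath.jump {d : ℕ} (ω : CadPath d) (t : ℝ) : Rd d :=
  ω.toFun t - Function.leftLim ω.toFun t

/-- The sublinear (upper) expectation associated with a family of measures:
`Ê[ξ] = sup_{P ∈ 𝔓} E^P[ξ]`. -/
def slE {Ωs : Type*} [MeasurableSpace Ωs] (P : Set (Measure Ωs)) (ξ : Ωs → ℝ) : ℝ :=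
  sSup ((fun μ : Measure Ωs => ∫ ω, ξ ω ∂μ) '' P)

/-- The capacity associated with a family of measures: `c(B) = sup_{P ∈ 𝔓} P(B)`. -/
def cap {Ωs : Type*} [MeasurableSpace Ωs] (P : Set (Measure Ωs)) (B : Set Ωs) : ℝ≥0∞ :=
  ⨆ μ ∈ P, μ B

/-- The `𝒱`-capacity associated with a family of Lévy measures: `c^𝒱(B) = sup_{v ∈ 𝒱} v(B)`. -/
def capV {d : ℕ} (V : Set (Measure (Rd d))) (B : Set (Rd d)) : ℝ≥0∞ :=
  ⨆ v ∈ V, v B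

/-- A random variable `Y` is quasi-continuous w.r.t. the capacity generated by `P` if for every
`ε > 0` there is an open set `O` with `c(O) < ε` such that `Y` is continuous on `Oᶜ`. -/
def QuasiContinuous {Ωs E : Type*} [MeasurableSpace Ωs] [TopologicalSpace Ωs]
    [TopologicalSpace E] (P : Set (Measure Ωs)) (Y : Ωs → E) : Prop :=
  ∀ ε : ℝ≥0∞, 0 < ε → ∃ O : Set Ωs, IsOpen O ∧ cap P O < ε ∧ ContinuousOn Y Oᶜ

/-- A stochastic process `Y` is quasi-continuous on a time interval `I` if for every `ε > 0`
there is an open set `O` with `c(O) < ε` such that `(t, ω) ↦ Y t ω` is continuous on `I × Oᶜ`. -/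
def ProcessQC {Ωs : Type*} [MeasurableSpace Ωs] [TopologicalSpace Ωs]
    (P : Set (Measure Ωs)) (I : Set ℝ) (Y : ℝ → Ωs → ℝ) : Prop :=
  ∀ ε : ℝ≥0∞, 0 < ε → ∃ O : Set Ωs, IsOpen O ∧ cap P O < ε ∧
    ContinuousOn (fun q : ℝ × Ωs => Y q.1 q.2) (I ×ˢ Oᶜ)

/-- A function on `ℝ^d_0 = ℝ^d \ {0}` is `𝒱`-quasi-continuous if for every `ε > 0` there is an
open subset `O` of `ℝ^d_0` with `c^𝒱(O) < ε` such that `f` is continuous outside `O` (within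
`ℝ^d_0`). -/
def VQuasiContinuous {d : ℕ} {E : Type*} [TopologicalSpace E] (V : Set (Measure (Rd d)))
    (f : Rd d → E) : Prop :=
  ∀ ε : ℝ≥0∞, 0 < ε → ∃ O : Set (Rd d), IsOpen O ∧ O ⊆ {0}ᶜ ∧ capV V O < ε ∧
    ContinuousOn f (Oᶜ \ {0})

/-- Bounded Lipschitz (test) functions. -/
def BddLip {α : Type*} [PseudoMetricSpace α] (φ : α → ℝ) : Prop :=
  (∃ K : ℝ≥0, LipschitzWith K φ) ∧ ∃ C : ℝ, ∀ x, |φ x| ≤ C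

/-- The (pathwise) Poisson integral `∫_A φ(z) L(t,dz)(ω) = ∑_{0<u≤t} φ(Δω_u) 1_A(Δω_u)`. -/
def poissonInt {d : ℕ} {E : Type*} [AddCommMonoid E] [TopologicalSpace E]
    (A : Set (Rd d)) (φ : Rd d → E) (t : ℝ) (ω : CadPath d) : E :=
  ∑' u : (Ioc (0:ℝ) t), A.indicator φ (ω.jump u)

/-- A weighted jump sum `∑_{0<u≤t} φ(Δω_u) g(u)`. -/
def weightedInt {d : ℕ} (φ : Rd d → ℝ) (g : ℝ → ℝ) (t : ℝ) (ω : CadPath d) : ℝ :=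
  ∑' u : (Ioc (0:ℝ) t), φ (ω.jump u) * g u

/-- A parameter `(v, p, Q)` of the Lévy–Khintchine representation. -/
abbrev LKparam (m : ℕ) := Measure (Rd m) × Rd m × Matrix (Fin m) (Fin m) ℝ

/-- `tr(QQᵀ)`. -/
def frob {m : ℕ} (Q : Matrix (Fin m) (Fin m) ℝ) : ℝ := Matrix.trace (Q * Q.transpose)

/-- `tr(D²f(0) QQᵀ) = ∑_k D²f(0)(Qe_k, Qe_k)`. -/
def qForm {m : ℕ} (f : Rd m → ℝ) (Q : Matrix (Fin m) (Fin m) ℝ) : ℝ :=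
  ∑ k : Fin m,
    iteratedFDeriv ℝ 2 f 0 ![toRd (Q.mulVec (Pi.single k 1)), toRd (Q.mulVec (Pi.single k 1))]

/-- The non-local operator with Lévy–Khintchine representation associated with the parameter
set `U`:
`G[f] = sup_{(v,p,Q) ∈ U} { ∫ f dv + ⟨Df(0), p⟩ + ½ tr(D²f(0) QQᵀ) }`. -/
def LKgen {m : ℕ} (U : Set (LKparam m)) (f : Rd m → ℝ) : ℝ :=
  sSup ((fun u : LKparam m =>
    (∫ z, f z ∂u.1) + fderiv ℝ f 0 u.2.1 + (1 / 2) * qForm f u.2.2) '' U)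

/-- A Lévy process under a sublinear expectation `E`: it starts at `0`, and has stationary
increments which are independent of the past (all in the distributional sense, expressed
through bounded Lipschitz test functions). -/
structure IsLevyProcess {Ωs : Type*} {m : ℕ} (E : (Ωs → ℝ) → ℝ) (Y : ℝ → Ωs → Rd m) : Prop where
  init : ∀ φ : Rd m → ℝ, BddLip φ → E (fun ω => φ (Y 0 ω)) = φ 0
  indep : ∀ (n : ℕ) (t : Fin n → ℝ) (s r : ℝ), (∀ i, 0 ≤ t i) → (∀ i, t i ≤ s) → 0 ≤ r →
    ∀ φ : (Fin n → Rd m) × Rd m → ℝ, BddLip φ →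
      E (fun ω => φ (fun i => Y (t i) ω, Y (s + r) ω - Y s ω)) =
        E (fun ω => E (fun ω' => φ (fun i => Y (t i) ω, Y (s + r) ω' - Y s ω')))
  stationary : ∀ s r : ℝ, 0 ≤ s → 0 ≤ r → ∀ φ : Rd m → ℝ, BddLip φ →
    E (fun ω => φ (Y (s + r) ω - Y s ω)) = E (fun ω => φ (Y r ω))

/-- A `G`-Lévy process associated with the parameter set `U` via the Lévy–Khintchine
representation: a Lévy process under the sublinear expectation `E` whose generator is the
non-local operator `LKgen U`. -/
structure IsGLevyProcess {Ωs : Type*} {m : ℕ} (E : (Ωs → ℝ) → ℝ) (Y : ℝ → Ωs → Rd m)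
    (U : Set (LKparam m)) extends IsLevyProcess E Y : Prop where
  generator : ∀ f : Rd m → ℝ, ContDiff ℝ 3 f → (∃ C, ∀ x, |f x| ≤ C) → f 0 = 0 →
    Tendsto (fun δ : ℝ => E (fun ω => f (Y δ ω)) / δ) (𝓝[>] 0) (𝓝 (LKgen U f))

/-- Assumption 1: there is `q < 1` with `sup_{v ∈ 𝒱} ∫_{0<|z|<1} |z|^q v(dz) < ∞`. -/
def Ass1 {d : ℕ} (V : Set (Measure (Rd d))) : Prop :=
  ∃ q : ℝ, q < 1 ∧
    (⨆ v ∈ V, ∫⁻ z in {z : Rd d | 0 < ‖z‖ ∧ ‖z‖ < 1}, (‖z‖₊ : ℝ≥0∞) ^ q ∂v) < ⊤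

/-- Assumption 2: there is `p > 1` with `sup_{v ∈ 𝒱} ∫_{|z|≥1} |z|^p v(dz) < ∞`. -/
def Ass2 {d : ℕ} (V : Set (Measure (Rd d))) : Prop :=
  ∃ p : ℝ, 1 < p ∧
    (⨆ v ∈ V, ∫⁻ z in {z : Rd d | 1 ≤ ‖z‖}, (‖z‖₊ : ℝ≥0∞) ^ p ∂v) < ⊤

/-- `‖f‖_{p,A,𝒱}^p = sup_{v ∈ 𝒱} ∫_A |f|^p dv`. -/
def vnorm {d : ℕ} (V : Set (Measure (Rd d))) (p : ℝ) (A : Set (Rd d)) (f : Rd d → ℝ) : ℝ≥0∞ :=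
  ⨆ v ∈ V, ∫⁻ z in A, (‖f z‖₊ : ℝ≥0∞) ^ p ∂v

/-- `f ∈ 𝕃^p(A,𝒱)`: Borel, vanishing outside `A`, with finite `‖·‖_{p,A,𝒱}` norm. -/
def MemLpV {d : ℕ} (V : Set (Measure (Rd d))) (p : ℝ) (A : Set (Rd d)) (f : Rd d → ℝ) : Prop :=
  Measurable f ∧ (∀ z ∉ A, f z = 0) ∧ vnorm V p A f < ⊤

/-- A bounded Borel function supported in a subset of `A` bounded away from `0`. -/
def ElemB {d : ℕ} (A : Set (Rd d)) (g : Rd d → ℝ) : Prop :=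
  Measurable g ∧ (∃ C, ∀ z, |g z| ≤ C) ∧
    ∃ B : Set (Rd d), B ⊆ A ∧ (0 : Rd d) ∉ closure B ∧ ∀ z ∉ B, g z = 0

/-- A bounded continuous function supported in a subset of `A` bounded away from `0`. -/
def ElemC {d : ℕ} (A : Set (Rd d)) (g : Rd d → ℝ) : Prop :=
  Continuous g ∧ (∃ C, ∀ z, |g z| ≤ C) ∧
    ∃ B : Set (Rd d), B ⊆ A ∧ (0 : Rd d) ∉ closure B ∧ ∀ z ∉ B, g z = 0

/-- `f ∈ 𝕃^p_b(A,𝒱)`: the completion (inside `𝕃^p(A,𝒱)`) of the bounded Borel functions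
supported in subsets of `A` bounded away from `0`. -/
def MemLpbV {d : ℕ} (V : Set (Measure (Rd d))) (p : ℝ) (A : Set (Rd d)) (f : Rd d → ℝ) : Prop :=
  MemLpV V p A f ∧ ∀ ε : ℝ≥0∞, 0 < ε →
    ∃ g, ElemB A g ∧ vnorm V p univ (fun z => f z - g z) < ε

/-- `f ∈ 𝕃^p_c(A,𝒱)`: the completion (inside `𝕃^p(A,𝒱)`) of the bounded continuous functions
supported in subsets of `A` bounded away from `0`. -/
def MemLpcV {d : ℕ} (V : Set (Measure (Rd d))) (p : ℝ) (A : Set (Rd d)) (f : Rd d → ℝ) : Prop :=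
  MemLpV V p A f ∧ ∀ ε : ℝ≥0∞, 0 < ε →
    ∃ g, ElemC A g ∧ vnorm V p univ (fun z => f z - g z) < ε

/-- `g` is `𝒱`-tight (relative to `A`). -/
def VTight {d : ℕ} (V : Set (Measure (Rd d))) (A : Set (Rd d)) (g : Rd d → ℝ) : Prop :=
  ∀ ε : ℝ≥0∞, 0 < ε → ∃ F : Set (Rd d), IsCompact F ∧ F ⊆ closure A ∧ (0 : Rd d) ∉ F ∧
    (⨆ v ∈ V, ∫⁻ z in Fᶜ, (‖g z‖₊ : ℝ≥0∞) ∂v) < ε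

/-- `g` is `𝒱`-uniformly integrable. -/
def VUnifInt {d : ℕ} (V : Set (Measure (Rd d))) (g : Rd d → ℝ) : Prop :=
  Tendsto (fun n : ℕ => ⨆ v ∈ V, ∫⁻ z in {z | (n : ℝ) ≤ |g z|}, (‖g z‖₊ : ℝ≥0∞) ∂v)
    atTop (𝓝 0)

/-- `f` has a `𝒱`-quasi-continuous version (i.e. a `𝒱`-q.c. function equal to `f`
outside a `𝒱`-polar subset of `ℝ^d_0`). -/
def HasVqcVersion {d : ℕ} (V : Set (Measure (Rd d))) (f : Rd d → ℝ) : Prop :=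
  ∃ g : Rd d → ℝ, VQuasiContinuous V g ∧ capV V {z | z ≠ 0 ∧ f z ≠ g z} = 0

/-- The canonical filtration `F_t = σ(X_u : 0 ≤ u ≤ t)` on the path space. -/
def pathFiltration (d : ℕ) (s : ℝ) : MeasurableSpace (CadPath d) :=
  ⨆ u ∈ Icc (0:ℝ) s, MeasurableSpace.comap (fun ω : CadPath d => ω.toFun u) inferInstance

/-- Cylindrical bounded Lipschitz functionals of the canonical process up to time `T`
(the space `Lip(Ω_T)`). -/
def CylLip (d : ℕ) (T : ℝ) (ξ : CadPath d → ℝ) : Prop :=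
  ∃ (n : ℕ) (t : Fin n → ℝ) (φ : (Fin n → Rd d) → ℝ),
    (∀ i, 0 ≤ t i ∧ t i ≤ T) ∧ BddLip φ ∧ ξ = fun ω => φ fun i => ω.toFun (t i)

/-- Membership in `L^p_G(Ω_T)`, the completion of `Lip(Ω_T)` under `Ê[|·|^p]^{1/p}`. -/
def MemLpG {d : ℕ} [MeasurableSpace (CadPath d)] (P : Set (Measure (CadPath d)))
    (p T : ℝ) (Y : CadPath d → ℝ) : Prop :=
  ∀ ε : ℝ, 0 < ε → ∃ ξ, CylLip d T ξ ∧ slE P (fun ω => |Y ω - ξ ω| ^ p) < ε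

/-- Membership in `𝕃^1_b(Ω_T)`, the completion under `Ê[|·|]` of the bounded
`F_T`-measurable random variables. -/
def MemL1bOmega {d : ℕ} [MeasurableSpace (CadPath d)] (P : Set (Measure (CadPath d)))
    (T : ℝ) (Y : CadPath d → ℝ) : Prop :=
  ∀ ε : ℝ, 0 < ε → ∃ ξ : CadPath d → ℝ, Measurable[pathFiltration d T] ξ ∧
    (∃ C, ∀ ω, |ξ ω| ≤ C) ∧ slE P (fun ω => |Y ω - ξ ω|) < ε

/-- Bounded random variables. -/
def Bdd {Ωs : Type*} (ξ : Ωs → ℝ) : Prop := ∃ C, ∀ ω, |ξ ω| ≤ C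

/-- A sublinear expectation: monotone, constant preserving, sub-additive and positively
homogeneous (on the lattice of bounded random variables). -/
def IsSublinearExp {Ωs : Type*} (E : (Ωs → ℝ) → ℝ) : Prop :=
  (∀ ξ η, Bdd ξ → Bdd η → (∀ ω, ξ ω ≤ η ω) → E ξ ≤ E η) ∧
  (∀ c : ℝ, E (fun _ => c) = c) ∧
  (∀ ξ η, Bdd ξ → Bdd η → E ξ - E η ≤ E (fun ω => ξ ω - η ω)) ∧
  (∀ ξ, Bdd ξ → ∀ l : ℝ, 0 ≤ l → E (fun ω => l * ξ ω) = l * E ξ)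

/-- A (time-consistent) family of conditional sublinear expectations `Ê[·|F_s]`
compatible with the sublinear expectation `E` and the filtration `F`. -/
structure IsCondExpSystem {Ωs : Type*} (E : (Ωs → ℝ) → ℝ) (F : ℝ → MeasurableSpace Ωs)
    (cond : ℝ → (Ωs → ℝ) → (Ωs → ℝ)) : Prop where
  meas : ∀ s ξ, Measurable[F s] (cond s ξ)
  mono : ∀ s ξ η, (∀ ω, ξ ω ≤ η ω) → ∀ ω, cond s ξ ω ≤ cond s η ω
  consistent : ∀ s ξ, E (cond s ξ) = E ξ
  tower : ∀ s t ξ, s ≤ t → cond s (cond t ξ) = cond s ξ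
  addMeas : ∀ s ξ η, Measurable[F s] η →
    cond s (fun ω => ξ ω + η ω) = fun ω => cond s ξ ω + η ω

/-- A `G`-martingale w.r.t. a family of conditional sublinear expectations:
`Ê[M_t | F_s] = M_s` for all `0 ≤ s ≤ t`. -/
def IsGMartingale {Ωs : Type*} (cond : ℝ → (Ωs → ℝ) → (Ωs → ℝ)) (M : ℝ → Ωs → ℝ) : Prop :=
  ∀ s t : ℝ, 0 ≤ s → s ≤ t → cond s (M t) = M s

/-- The successive jump times `τ^k_A` of the canonical process with jump size in `A`
(valued in `[0,∞]`). -/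
def tauTimes {d : ℕ} (A : Set (Rd d)) : ℕ → CadPath d → ℝ≥0∞
  | 0, _ => 0
  | k + 1, ω => sInf {t : ℝ≥0∞ | tauTimes A k ω < t ∧ t ≠ ⊤ ∧ ω.jump t.toReal ∈ A}

/-- The canonical sublinear expectation space of a `G`-Lévy process: the canonical process
`X_t(ω) = ω_t` on the Skorohod space is a `G`-Lévy process associated with the set `U`
(satisfying the boundedness condition of the Lévy–Khintchine representation) under the
sublinear expectation `Ê = sup_{P ∈ 𝔓} E^P`, where `𝔓` is a family of probability measures. -/
structure Setting (d : ℕ) [TopologicalSpace (CadPath d)] [MeasurableSpace (CadPath d)] where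
  P : Set (Measure (CadPath d))
  prob : ∀ μ ∈ P, IsProbabilityMeasure μ
  U : Set (LKparam d)
  levyU : ∀ u ∈ U, u.1 {0} = 0
  bddU : ∃ M : ℝ≥0, ∀ u ∈ U,
    (∫⁻ z, (‖z‖₊ : ℝ≥0∞) ∂u.1) + (‖u.2.1‖₊ : ℝ≥0∞) + ENNReal.ofReal (frob u.2.2) ≤ (M : ℝ≥0∞)
  glevy : IsGLevyProcess (slE P) (fun (t : ℝ) (ω : CadPath d) => ω.toFun t) U

/-- The set `𝒱` of Lévy measures appearing in `U`. -/
def Setting.V {d : ℕ} [TopologicalSpace (CadPath d)] [MeasurableSpace (CadPath d)]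
    (S : Setting d) : Set (Measure (Rd d)) :=
  {v | ∃ p Q, (v, p, Q) ∈ S.U}

/-- A canonical setting together with a family of conditional sublinear expectations. -/
structure MSetting (d : ℕ) [TopologicalSpace (CadPath d)] [MeasurableSpace (CadPath d)]
    extends Setting d where
  cond : ℝ → (CadPath d → ℝ) → (CadPath d → ℝ)
  condSys : IsCondExpSystem (slE P) (pathFiltration d) cond

end

theorem CadPath.tendsto_leftLim {d : ℕ} (ω : CadPath d) {t : ℝ} (ht : 0 < t) :
    Tendsto ω.toFun (𝓝[<] t) (𝓝 (Function.leftLim ω.toFun t)) := by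
  obtain ⟨L, hL⟩ := ω.cadlag'.2 t ht
  rwa [leftLim_eq_of_tendsto hL]

theorem CadPath.tendsto_nhdsGE {d : ℕ} (ω : CadPath d) {t : ℝ} (ht : 0 ≤ t) :
    Tendsto ω.toFun (𝓝[≥] t) (𝓝 (ω.toFun t)) :=
  ω.cadlag'.1 t ht

/-- If the path stays within `ρ` of `L` on an open interval, its jumps there are at most `2ρ`. -/
theorem CadPath.norm_jump_le {d : ℕ} (ω : CadPath d) {a b u ρ : ℝ} {L : Rd d} (ha : 0 ≤ a)
    (hu : u ∈ Ioo a b) (h : ∀ s ∈ Ioo a b, ω.toFun s ∈ Metric.closedBall L ρ) :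
    ‖ω.jump u‖ ≤ 2 * ρ := by
  have hl : Function.leftLim ω.toFun u ∈ Metric.closedBall L ρ := by
    refine Metric.isClosed_closedBall.mem_of_tendsto (ω.tendsto_leftLim (ha.trans_lt hu.1)) ?_
    filter_upwards [Ioo_mem_nhdsLT hu.1] with s hs
    exact h s ⟨hs.1, hs.2.trans hu.2⟩
  have h1 := h u hu
  rw [Metric.mem_closedBall, dist_eq_norm] at h1 hl
  have h2 : ω.jump u = (ω.toFun u - L) - (Function.leftLim ω.toFun u - L) := by
    simp [CadPath.jump]
  rw [h2]
  linarith [norm_sub_le (ω.toFun u - L) (Function.leftLim ω.toFun u - L)]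

/-- A càdlàg path has finitely many jumps of size at least `r` on a bounded time interval. -/
theorem CadPath.finite_large_jumps {d : ℕ} (ω : CadPath d) (T : ℝ) {r : ℝ} (hr : 0 < r) :
    {u | u ∈ Ioc 0 T ∧ r ≤ ‖ω.jump u‖}.Finite := by
  by_contra hinf
  obtain ⟨t, ht, hacc⟩ := Set.Infinite.exists_accPt_of_subset_isCompact hinf
    (isCompact_Icc (a := (0 : ℝ)) (b := T)) (fun u hu => Ioc_subset_Icc_self hu.1)
  rw [accPt_iff_frequently_nhdsNE] at hacc
  refine hacc ?_
  rw [← nhdsLT_sup_nhdsGT, eventually_sup]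
  have hball : ∀ L : Rd d, Metric.closedBall L (r / 3) ∈ 𝓝 L := fun L =>
    Metric.closedBall_mem_nhds L (by positivity)
  constructor
  · rcases ht.1.eq_or_lt with h0 | h0
    · filter_upwards [self_mem_nhdsWithin] with u hu hu'
      have : u < t := hu
      linarith [hu'.1.1]
    · have h1 := (ω.tendsto_leftLim h0).eventually (hball _)
      obtain ⟨a, ha, hsub⟩ := (mem_nhdsLT_iff_exists_Ioo_subset' h0).1 h1
      have hm : max a 0 < t := max_lt ha h0
      filter_upwards [Ioo_mem_nhdsLT hm] with u hu hu'
      have := ω.norm_jump_le (le_max_right a 0) hu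
        (fun s hs => hsub ⟨(le_max_left a 0).trans_lt hs.1, hs.2⟩)
      linarith [hu'.2]
  · have h1 := ((ω.tendsto_nhdsGE ht.1).mono_left (nhdsWithin_mono t Ioi_subset_Ici_self)).eventually
      (hball _)
    obtain ⟨b, hb, hsub⟩ := mem_nhdsGT_iff_exists_Ioo_subset.1 h1
    filter_upwards [Ioo_mem_nhdsGT hb] with u hu hu'
    have := ω.norm_jump_le ht.1 hu hsub
    linarith [hu'.2]

/-- A continuous Poisson integral forces the absence of jumps charged by the integrand. -/
theorem CadPath.jump_eq_zero_of_continuousOn {d : ℕ} (ω : CadPath d) {φ : Rd d → ℝ} {r T : ℝ}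
    (hr : 0 < r) (hφ : ∀ z : Rd d, ‖z‖ < r → φ z = 0)
    (hc : ContinuousOn (fun t => poissonInt {z : Rd d | z ≠ 0} φ t ω) (Icc 0 T)) :
    ∀ u ∈ Ioc 0 T, φ (ω.jump u) = 0 := by
  intro u hu
  have hind : {z : Rd d | z ≠ 0}.indicator φ = φ := by
    rw [indicator_eq_self]
    intro z hz h0
    exact hz (hφ z (by simpa [h0] using hr))
  set F := (ω.finite_large_jumps T hr).toFinset with hF
  have hsum : ∀ t ≤ T, poissonInt {z : Rd d | z ≠ 0} φ t ω
      = ∑ s ∈ F, (Ioc 0 t).indicator (fun s => φ (ω.jump s)) s := by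
    intro t ht
    rw [poissonInt, hind, tsum_subtype (Ioc 0 t) (fun s => φ (ω.jump s))]
    refine tsum_eq_sum fun s hs => ?_
    by_cases hst : s ∈ Ioc 0 t
    · rw [indicator_of_mem hst]
      refine hφ _ (not_le.1 fun h => hs ?_)
      simpa [hF] using ⟨⟨hst.1, hst.2.trans ht⟩, h⟩
    · exact indicator_of_notMem hst _
  have hev : ∀ᶠ t in 𝓝[<] u, ∀ s ∈ F, (Ioc 0 t).indicator (fun s => φ (ω.jump s)) s
      = (Ioo 0 u).indicator (fun s => φ (ω.jump s)) s := by
    rw [Filter.eventually_all_finset]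
    intro s _
    by_cases hsu : s < u
    · filter_upwards [Ioo_mem_nhdsLT hsu] with t ht
      simp only [indicator, mem_Ioc, mem_Ioo, ht.1.le, hsu]
    · filter_upwards [self_mem_nhdsWithin] with t ht
      have ht : t < u := ht
      have : ¬ s ≤ t := by linarith
      simp only [indicator, mem_Ioc, mem_Ioo, this, hsu]
  have hlim1 : Tendsto (fun t => poissonInt {z : Rd d | z ≠ 0} φ t ω) (𝓝[<] u)
      (𝓝 (∑ s ∈ F, (Ioo 0 u).indicator (fun s => φ (ω.jump s)) s)) := by
    refine tendsto_const_nhds.congr' ?_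
    filter_upwards [hev, self_mem_nhdsWithin] with t ht htu
    rw [hsum t ((le_of_lt htu).trans hu.2)]
    exact Finset.sum_congr rfl fun s hs => (ht s hs).symm
  have hlim2 : Tendsto (fun t => poissonInt {z : Rd d | z ≠ 0} φ t ω) (𝓝[<] u)
      (𝓝 (∑ s ∈ F, (Ioc 0 u).indicator (fun s => φ (ω.jump s)) s)) := by
    rw [← hsum u hu.2]
    refine (hc u ⟨hu.1.le, hu.2⟩).tendsto.mono_left ?_
    refine nhdsWithin_le_of_mem ?_
    filter_upwards [Ioo_mem_nhdsLT hu.1] with t ht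
    exact ⟨ht.1.le, ht.2.le.trans hu.2⟩
  have heq := tendsto_nhds_unique hlim1 hlim2
  by_contra hne
  have huF : u ∈ F := by
    have : r ≤ ‖ω.jump u‖ := not_lt.1 fun h => hne (hφ _ h)
    simpa [hF] using ⟨hu, this⟩
  rw [← Finset.add_sum_erase _ _ huF, ← Finset.add_sum_erase _ _ huF] at heq
  have hrest : ∑ s ∈ F.erase u, (Ioo 0 u).indicator (fun s => φ (ω.jump s)) s
      = ∑ s ∈ F.erase u, (Ioc 0 u).indicator (fun s => φ (ω.jump s)) s := by
    refine Finset.sum_congr rfl fun s hs => ?_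
    have : s < u ↔ s ≤ u := ⟨le_of_lt, fun h => h.lt_of_ne (Finset.ne_of_mem_erase hs)⟩
    simp only [indicator, mem_Ioo, mem_Ioc, this]
  rw [hrest] at heq
  simp [indicator, hu.1] at heq
  exact hne heq

/-- If no jump on `(0, δ]` lies in the closed set `K ∌ 0`, then the increments over sufficiently
fine regular partitions of `[0, δ]` avoid `K`. -/
theorem CadPath.eventually_increments_notMem {d : ℕ} (ω : CadPath d) {δ : ℝ} (hδ : 0 < δ)
    {K : Set (Rd d)} (hK : IsClosed K) (h0 : (0 : Rd d) ∉ K)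
    (hjump : ∀ u ∈ Ioc 0 δ, ω.jump u ∉ K) :
    ∀ᶠ n : ℕ in atTop, ∀ j < n,
      ω.toFun ((j + 1 : ℕ) * (δ / n)) - ω.toFun (j * (δ / n)) ∉ K := by
  by_contra hcon
  have hfreq : ∃ᶠ n : ℕ in atTop, ∃ j < n,
      ω.toFun ((j + 1 : ℕ) * (δ / n)) - ω.toFun (j * (δ / n)) ∈ K := by
    simpa [Filter.Frequently] using hcon
  set B : Set ℕ := {n : ℕ | ∃ j < n,
      ω.toFun ((j + 1 : ℕ) * (δ / n)) - ω.toFun (j * (δ / n)) ∈ K}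
  have : (atTop ⊓ 𝓟 B).NeBot := Filter.frequently_mem_iff_neBot.1 hfreq
  set 𝒰 := Ultrafilter.of (atTop ⊓ 𝓟 B)
  have h𝒰 : (𝒰 : Filter ℕ) ≤ atTop ⊓ 𝓟 B := Ultrafilter.of_le _
  have hB : ∀ᶠ n in (𝒰 : Filter ℕ), n ∈ B := h𝒰 (mem_inf_of_right (mem_principal_self B))
  have htop : (𝒰 : Filter ℕ) ≤ atTop := h𝒰.trans inf_le_left
  classical
  let j : ℕ → ℕ := fun n => if h : n ∈ B then h.choose else 0
  have hj : ∀ n ∈ B, j n < n ∧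
      ω.toFun ((j n + 1 : ℕ) * (δ / n)) - ω.toFun (j n * (δ / n)) ∈ K := by
    intro n hn
    simp only [j, dif_pos hn]
    exact hn.choose_spec
  set s : ℕ → ℝ := fun n => j n * (δ / n) with hs
  set s' : ℕ → ℝ := fun n => (j n + 1 : ℕ) * (δ / n) with hs'
  have hsI : ∀ᶠ n in (𝒰 : Filter ℕ), s n ∈ Icc 0 δ := by
    filter_upwards [hB] with n hn
    have h1 := (hj n hn).1
    have hn0 : (0 : ℝ) < n := by exact_mod_cast (Nat.zero_le _).trans_lt h1
    refine ⟨by positivity, ?_⟩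
    have h2 : (j n : ℝ) ≤ n := by exact_mod_cast h1.le
    calc s n ≤ n * (δ / n) := by simp only [hs]; gcongr
      _ = δ := by field_simp
  have hsI' : ∀ᶠ n in (𝒰 : Filter ℕ), s' n ∈ Icc 0 δ := by
    filter_upwards [hB] with n hn
    have h1 := (hj n hn).1
    have hn0 : (0 : ℝ) < n := by exact_mod_cast (Nat.zero_le _).trans_lt h1
    refine ⟨by positivity, ?_⟩
    have h2 : ((j n + 1 : ℕ) : ℝ) ≤ n := by exact_mod_cast h1
    calc s' n ≤ n * (δ / n) := by simp only [hs']; gcongr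
      _ = δ := by field_simp
  obtain ⟨t, ht, hst⟩ := isCompact_Icc.ultrafilter_le_nhds (𝒰.map s)
    (le_principal_iff.2 hsI)
  have hst : Tendsto s 𝒰 (𝓝 t) := hst
  have hst' : Tendsto s' 𝒰 (𝓝 t) := by
    have h1 : Tendsto (fun n : ℕ => δ / (n : ℝ)) 𝒰 (𝓝 0) :=
      (tendsto_const_div_atTop_nhds_zero_nat δ).mono_left htop
    have h2 : s' = fun n => s n + δ / n := by
      funext n
      simp only [hs, hs']
      push_cast
      ring
    rw [h2]
    simpa using hst.add h1
  have hinc : ∀ᶠ n in (𝒰 : Filter ℕ), ω.toFun (s' n) - ω.toFun (s n) ∈ K := by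
    filter_upwards [hB] with n hn using (hj n hn).2
  have hle : ∀ n, s n ≤ s' n := by
    intro n
    simp only [hs, hs']
    have : (0 : ℝ) ≤ δ / n := by positivity
    push_cast
    nlinarith
  have hge : ∀ {v : ℕ → ℝ}, Tendsto v 𝒰 (𝓝 t) → (∀ᶠ n in (𝒰 : Filter ℕ), ¬ v n < t) →
      Tendsto (fun n => ω.toFun (v n)) 𝒰 (𝓝 (ω.toFun t)) := fun hv hvt =>
    (ω.tendsto_nhdsGE ht.1).comp (tendsto_nhdsWithin_iff.2 ⟨hv, hvt.mono fun n hn => not_lt.1 hn⟩)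
  have hlt : ∀ {v : ℕ → ℝ}, 0 < t → Tendsto v 𝒰 (𝓝 t) → (∀ᶠ n in (𝒰 : Filter ℕ), v n < t) →
      Tendsto (fun n => ω.toFun (v n)) 𝒰 (𝓝 (Function.leftLim ω.toFun t)) := fun h hv hvt =>
    (ω.tendsto_leftLim h).comp (tendsto_nhdsWithin_iff.2 ⟨hv, hvt⟩)
  rcases 𝒰.em (fun n => s n < t) with h1 | h1
  · have htpos : 0 < t := by
      obtain ⟨n, hn1, hn2⟩ := (h1.and hsI).exists
      exact hn2.1.trans_lt hn1
    rcases 𝒰.em (fun n => s' n < t) with h2 | h2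
    · have := hK.mem_of_tendsto ((hlt htpos hst' h2).sub (hlt htpos hst h1)) hinc
      exact h0 (by simpa using this)
    · have := hK.mem_of_tendsto ((hge hst' h2).sub (hlt htpos hst h1)) hinc
      exact hjump t ⟨htpos, ht.2⟩ this
  · have h2 : ∀ᶠ n in (𝒰 : Filter ℕ), ¬ s' n < t := h1.mono fun n hn h => hn ((hle n).trans_lt h)
    have := hK.mem_of_tendsto ((hge hst' h2).sub (hge hst h1)) hinc
    exact h0 (by simpa using this)

section SublinearExpectation

variable {Ωs : Type*} [MeasurableSpace Ωs] {P : Set (Measure Ωs)}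

theorem integral_le_slE (hP : ∀ μ ∈ P, IsProbabilityMeasure μ) {ξ : Ωs → ℝ} (hξ : Bdd ξ)
    {μ : Measure Ωs} (hμ : μ ∈ P) : ∫ ω, ξ ω ∂μ ≤ slE P ξ := by
  obtain ⟨C, hC⟩ := hξ
  refine le_csSup ⟨C, ?_⟩ ⟨μ, hμ, rfl⟩
  rintro _ ⟨ν, hν, rfl⟩
  have := hP ν hν
  have h := norm_integral_le_of_norm_le_const (μ := ν) (f := ξ) (C := C) (ae_of_all _ hC)
  simp only [probReal_univ, mul_one, Real.norm_eq_abs] at h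
  exact (le_abs_self _).trans h

theorem exists_lt_integral_of_lt_slE (hne : P.Nonempty) {ξ : Ωs → ℝ} {c : ℝ} (h : c < slE P ξ) :
    ∃ μ ∈ P, c < ∫ ω, ξ ω ∂μ := by
  obtain ⟨_, ⟨μ, hμ, rfl⟩, hlt⟩ := exists_lt_of_lt_csSup (hne.image _) h
  exact ⟨μ, hμ, hlt⟩

theorem slE_le (hne : P.Nonempty) {ξ : Ωs → ℝ} {c : ℝ} (h : ∀ μ ∈ P, ∫ ω, ξ ω ∂μ ≤ c) :
    slE P ξ ≤ c :=
  csSup_le (hne.image _) (by rintro _ ⟨μ, hμ, rfl⟩; exact h μ hμ)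

theorem slE_const_mul {c : ℝ} (hc : 0 ≤ c) (ξ : Ωs → ℝ) :
    slE P (fun ω => c * ξ ω) = c * slE P ξ := by
  have := Real.sSup_smul_of_nonneg hc ((fun μ : Measure Ωs => ∫ ω, ξ ω ∂μ) '' P)
  rw [smul_eq_mul] at this
  rw [slE, slE, ← this, ← image_smul, image_image]
  simp only [integral_const_mul, smul_eq_mul]

theorem slE_sub_self (hP : ∀ μ ∈ P, IsProbabilityMeasure μ) (hne : P.Nonempty) {ξ : Ωs → ℝ}
    (hξ : Bdd ξ) (hi : ∀ μ ∈ P, Integrable ξ μ) : slE P (fun ω => ξ ω - slE P ξ) = 0 := by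
  have key : ∀ μ ∈ P, ∫ ω, (ξ ω - slE P ξ) ∂μ = ∫ ω, ξ ω ∂μ - slE P ξ := by
    intro μ hμ
    have := hP μ hμ
    rw [integral_sub (hi μ hμ) (integrable_const _)]
    simp
  have hb : Bdd (fun ω => ξ ω - slE P ξ) := by
    obtain ⟨C, hC⟩ := hξ
    exact ⟨C + |slE P ξ|, fun ω => (abs_sub _ _).trans (by linarith [hC ω])⟩
  refine le_antisymm (slE_le hne fun μ hμ => ?_) ?_
  · rw [key μ hμ]
    linarith [integral_le_slE hP hξ hμ]
  · by_contra! hlt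
    obtain ⟨μ, hμ, h⟩ := exists_lt_integral_of_lt_slE hne
      (show slE P ξ + slE P (fun ω => ξ ω - slE P ξ) < slE P ξ by linarith)
    have h2 := integral_le_slE hP hb hμ
    rw [key μ hμ] at h2
    linarith

/-- If a random variable with positive upper expectation is not integrable under some measure of
the family, then shifting it by a constant shifts the upper expectation, truncated at `0`. -/
theorem slE_add_const_of_not_integrable (hP : ∀ μ ∈ P, IsProbabilityMeasure μ) {ξ : Ωs → ℝ}
    (hξ : Bdd ξ) (hpos : 0 < slE P ξ) {μ₀ : Measure Ωs} (hμ₀ : μ₀ ∈ P) (hni : ¬ Integrable ξ μ₀)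
    (c : ℝ) : slE P (fun ω => ξ ω + c) = max 0 (slE P ξ + c) := by
  have hne : P.Nonempty := ⟨μ₀, hμ₀⟩
  have hb : Bdd (fun ω => ξ ω + c) := by
    obtain ⟨C, hC⟩ := hξ
    exact ⟨C + |c|, fun ω => (abs_add_le _ _).trans (by linarith [hC ω])⟩
  have hadd : ∀ μ ∈ P, Integrable ξ μ → ∫ ω, (ξ ω + c) ∂μ = ∫ ω, ξ ω ∂μ + c := by
    intro μ hμ hi
    have := hP μ hμ
    rw [integral_add hi (integrable_const _)]
    simp
  have hnot : ∀ μ ∈ P, ¬ Integrable ξ μ → ∫ ω, (ξ ω + c) ∂μ = 0 := by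
    intro μ hμ hi
    have := hP μ hμ
    refine integral_undef fun h => hi ?_
    exact (h.sub (integrable_const c)).congr (ae_of_all _ fun ω => by simp)
  refine le_antisymm (slE_le hne fun μ hμ => ?_) (max_le ?_ ?_)
  · by_cases hi : Integrable ξ μ
    · rw [hadd μ hμ hi]
      exact le_max_of_le_right (by linarith [integral_le_slE hP hξ hμ])
    · rw [hnot μ hμ hi]
      exact le_max_left _ _
  · rw [← hnot μ₀ hμ₀ hni]
    exact integral_le_slE hP hb hμ₀
  · by_contra! hlt
    obtain ⟨μ, hμ, h⟩ := exists_lt_integral_of_lt_slE hne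
      (show max (slE P (fun ω => ξ ω + c) - c) 0 < slE P ξ from max_lt (by linarith) hpos)
    have hi : Integrable ξ μ := by
      by_contra hi
      rw [integral_undef hi] at h
      exact absurd (le_max_right _ _) (not_le.2 h)
    have h2 := integral_le_slE hP hb hμ
    rw [hadd μ hμ hi] at h2
    linarith [(le_max_left _ _).trans_lt h]

end SublinearExpectation

section BoundedLipschitz

variable {α β : Type*} [PseudoMetricSpace α] [PseudoMetricSpace β]

theorem BddLip.comp {f : β → ℝ} (hf : BddLip f) {g : α → β} {K : ℝ≥0} (hg : LipschitzWith K g) :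
    BddLip (f ∘ g) := by
  obtain ⟨⟨L, hL⟩, C, hC⟩ := hf
  exact ⟨⟨L * K, hL.comp hg⟩, C, fun x => hC _⟩

theorem BddLip.add {f g : α → ℝ} (hf : BddLip f) (hg : BddLip g) :
    BddLip (fun x => f x + g x) := by
  obtain ⟨⟨L, hL⟩, C, hC⟩ := hf
  obtain ⟨⟨L', hL'⟩, C', hC'⟩ := hg
  exact ⟨⟨L + L', hL.add hL'⟩, C + C', fun x => (abs_add_le _ _).trans (add_le_add (hC x) (hC' x))⟩

theorem BddLip.const (c : ℝ) : BddLip (fun _ : α => c) :=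
  ⟨⟨0, LipschitzWith.const c⟩, |c|, fun _ => le_rfl⟩

theorem BddLip.mul {f g : α → ℝ} (hf : BddLip f) (hg : BddLip g) :
    BddLip (fun x => f x * g x) := by
  obtain ⟨⟨L, hL⟩, C, hC⟩ := hf
  obtain ⟨⟨L', hL'⟩, C', hC'⟩ := hg
  refine ⟨⟨L * C'.toNNReal + C.toNNReal * L', LipschitzWith.of_dist_le_mul fun x y => ?_⟩,
    C * C', fun x => ?_⟩
  · have h1 := hL.dist_le_mul x y
    have h2 := hL'.dist_le_mul x y
    have h3 : |g x| ≤ C'.toNNReal := (hC' x).trans (Real.le_coe_toNNReal _)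
    have h4 : |f y| ≤ C.toNNReal := (hC y).trans (Real.le_coe_toNNReal _)
    rw [Real.dist_eq] at h1 h2 ⊢
    have h5 : f x * g x - f y * g y = (f x - f y) * g x + f y * (g x - g y) := by ring
    rw [h5]
    refine (abs_add_le _ _).trans ?_
    rw [abs_mul, abs_mul]
    push_cast
    calc _ ≤ (L * dist x y) * C'.toNNReal + C.toNNReal * (L' * dist x y) := by gcongr
      _ = _ := by ring
  · rw [abs_mul]
    exact mul_le_mul (hC x) (hC' x) (abs_nonneg _) ((abs_nonneg _).trans (hC x))

theorem BddLip.bdd_comp {Ωs : Type*} {f : α → ℝ} (hf : BddLip f) (X : Ωs → α) :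
    Bdd (fun ω => f (X ω)) :=
  let ⟨C, hC⟩ := hf.2
  ⟨C, fun _ => hC _⟩

end BoundedLipschitz

theorem ContDiffBump.bddLip {d : ℕ} {c : Rd d} (f : ContDiffBump c) : BddLip (f : Rd d → ℝ) := by
  refine ⟨(f.contDiff (n := 1)).lipschitzWith_of_hasCompactSupport f.hasCompactSupport (by simp),
    1, fun x => ?_⟩
  rw [abs_of_nonneg f.nonneg]
  exact f.le_one

theorem frob_eq_sum {m : ℕ} (Q : Matrix (Fin m) (Fin m) ℝ) :
    frob Q = ∑ k, ‖toRd (Q.mulVec (Pi.single k 1))‖ ^ 2 := by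
  simp only [EuclideanSpace.real_norm_sq_eq, Matrix.mulVec_single_one]
  rw [Finset.sum_comm, frob, Matrix.trace]
  refine Finset.sum_congr rfl fun i _ => ?_
  simp only [Matrix.diag_apply, Matrix.mul_apply, Matrix.transpose_apply]
  refine Finset.sum_congr rfl fun k _ => ?_
  exact (sq (Q i k)).symm

theorem abs_qForm_le {m : ℕ} (f : Rd m → ℝ) (Q : Matrix (Fin m) (Fin m) ℝ) :
    |qForm f Q| ≤ ‖iteratedFDeriv ℝ 2 f 0‖ * frob Q := by
  rw [frob_eq_sum, Finset.mul_sum]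
  refine (Finset.abs_sum_le_sum_abs _ _).trans (Finset.sum_le_sum fun k _ => ?_)
  refine ((iteratedFDeriv ℝ 2 f 0).le_opNorm _).trans_eq ?_
  simp [Fin.prod_univ_two, sq]

/-- The value at the parameter `u` of the functional whose supremum is `LKgen`. -/
noncomputable def LKval {m : ℕ} (f : Rd m → ℝ) (u : LKparam m) : ℝ :=
  (∫ z, f z ∂u.1) + fderiv ℝ f 0 u.2.1 + (1 / 2) * qForm f u.2.2

theorem integrable_of_lipschitzWith {m : ℕ} {v : Measure (Rd m)}
    (hv : ∫⁻ z, (‖z‖₊ : ℝ≥0∞) ∂v ≠ ⊤) {f : Rd m → ℝ} {K : ℝ≥0} (hf : LipschitzWith K f)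
    (h0 : f 0 = 0) : Integrable f v := by
  have hid : Integrable (fun z : Rd m => z) v :=
    ⟨measurable_id.aestronglyMeasurable, lt_top_iff_ne_top.2 hv⟩
  refine (hid.norm.const_mul (K : ℝ)).mono' hf.continuous.aestronglyMeasurable
    (ae_of_all _ fun z => ?_)
  have := hf.dist_le_mul z 0
  rwa [h0, dist_zero_right, dist_zero_right] at this

theorem LKval_add_const_mul {m : ℕ} {u : LKparam m} (hu : ∫⁻ z, (‖z‖₊ : ℝ≥0∞) ∂u.1 ≠ ⊤)
    {f h : Rd m → ℝ} (hf : ContDiff ℝ 3 f) (hh : ContDiff ℝ 3 h) (hfl : BddLip f) (hhl : BddLip h)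
    (hf0 : f 0 = 0) (hh0 : h 0 = 0) (c : ℝ) :
    LKval (fun x => f x + c * h x) u = LKval f u + c * LKval h u := by
  obtain ⟨⟨K, hK⟩, -⟩ := hfl
  obtain ⟨⟨L, hL⟩, -⟩ := hhl
  have hfd : DifferentiableAt ℝ f 0 := (hf.differentiable (by simp)).differentiableAt
  have hhd : DifferentiableAt ℝ h 0 := (hh.differentiable (by simp)).differentiableAt
  have h2 : ((2 : ℕ) : WithTop ℕ∞) ≤ 3 := by norm_num
  have hit : iteratedFDeriv ℝ 2 (fun x => f x + c * h x) 0
      = iteratedFDeriv ℝ 2 f 0 + c • iteratedFDeriv ℝ 2 h 0 := by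
    have hh2 : ContDiffAt ℝ ((2 : ℕ) : WithTop ℕ∞) h 0 := (hh.of_le h2).contDiffAt
    rw [← iteratedFDeriv_const_smul_apply' hh2]
    exact iteratedFDeriv_add_apply (hf.of_le h2).contDiffAt (hh2.const_smul c)
  have hq : qForm (fun x => f x + c * h x) u.2.2 = qForm f u.2.2 + c * qForm h u.2.2 := by
    simp only [qForm, hit, Finset.mul_sum, ← Finset.sum_add_distrib]
    rfl
  have hd : fderiv ℝ (fun x => f x + c * h x) 0 = fderiv ℝ f 0 + c • fderiv ℝ h 0 := by
    rw [fderiv_fun_add hfd (hhd.const_mul c), fderiv_const_mul hhd]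
  have hint : ∫ z, (f z + c * h z) ∂u.1 = ∫ z, f z ∂u.1 + c * ∫ z, h z ∂u.1 := by
    rw [integral_add (integrable_of_lipschitzWith hu hK hf0)
      ((integrable_of_lipschitzWith hu hL hh0).const_mul c), integral_const_mul]
  simp only [LKval, hq, hd, hint, add_apply, smul_apply,
    smul_eq_mul]
  ring

theorem LKval_eq_integral {m : ℕ} {f : Rd m → ℝ} (hf : f =ᶠ[𝓝 0] 0) (u : LKparam m) :
    LKval f u = ∫ z, f z ∂u.1 := by
  have h1 : fderiv ℝ f 0 = 0 := by
    rw [hf.fderiv_eq]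
    exact fderiv_const_apply 0
  have h2 : iteratedFDeriv ℝ 2 f 0 = 0 := by
    rw [(hf.iteratedFDeriv ℝ 2).eq_of_nhds]
    simp
  simp [LKval, qForm, h1, h2]

namespace Setting

variable {d : ℕ} [TopologicalSpace (CadPath d)] [MeasurableSpace (CadPath d)] (S : Setting d)

theorem lintegral_norm_ne_top {u : LKparam d} (hu : u ∈ S.U) :
    ∫⁻ z, (‖z‖₊ : ℝ≥0∞) ∂u.1 ≠ ⊤ := by
  obtain ⟨M, hM⟩ := S.bddU
  refine ne_top_of_le_ne_top (ENNReal.coe_ne_top (r := M)) (le_trans ?_ (hM u hu))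
  rw [add_assoc]
  exact le_self_add

theorem LKval_le_LKgen {f : Rd d → ℝ} (hf : BddLip f) (h0 : f 0 = 0) {u : LKparam d}
    (hu : u ∈ S.U) : LKval f u ≤ LKgen S.U f := by
  obtain ⟨M, hM⟩ := S.bddU
  obtain ⟨⟨K, hK⟩, -⟩ := hf
  refine le_csSup ⟨K * M + ‖fderiv ℝ f 0‖ * M + 1 / 2 * (‖iteratedFDeriv ℝ 2 f 0‖ * M), ?_⟩
    ⟨u, hu, rfl⟩
  rintro _ ⟨w, hw, rfl⟩
  have hMw := hM w hw
  have h1 : ∫⁻ z, (‖z‖₊ : ℝ≥0∞) ∂w.1 ≤ M := le_trans (by rw [add_assoc]; exact le_self_add) hMw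
  have h2 : (‖w.2.1‖₊ : ℝ≥0∞) ≤ M :=
    le_trans (by rw [add_comm (∫⁻ z, _ ∂_), add_assoc]; exact le_self_add) hMw
  have h3 : ENNReal.ofReal (frob w.2.2) ≤ M := le_trans le_add_self hMw
  have h2' : ‖w.2.1‖ ≤ M := by exact_mod_cast h2
  have h3' : frob w.2.2 ≤ M := by
    rw [← ENNReal.ofReal_coe_nnreal] at h3
    exact (ENNReal.ofReal_le_ofReal_iff M.coe_nonneg).1 h3
  have hw' := S.lintegral_norm_ne_top hw
  have hid : Integrable (fun z : Rd d => z) w.1 :=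
    ⟨measurable_id.aestronglyMeasurable, lt_top_iff_ne_top.2 hw'⟩
  have hn : ∫ z, ‖z‖ ∂w.1 ≤ M := by
    rw [integral_norm_eq_lintegral_enorm hid.aestronglyMeasurable]
    exact ENNReal.toReal_le_of_le_ofReal M.coe_nonneg (by rw [ENNReal.ofReal_coe_nnreal]; exact h1)
  have hi : ∫ z, f z ∂w.1 ≤ K * M := by
    calc ∫ z, f z ∂w.1 ≤ ∫ z, K * ‖z‖ ∂w.1 := by
          refine integral_mono (integrable_of_lipschitzWith hw' hK h0) (hid.norm.const_mul _)
            fun z => ?_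
          have := hK.dist_le_mul z 0
          rw [h0, dist_zero_right, dist_zero_right] at this
          exact (le_abs_self _).trans this
      _ = K * ∫ z, ‖z‖ ∂w.1 := integral_const_mul _ _
      _ ≤ K * M := by gcongr
  have hd : fderiv ℝ f 0 w.2.1 ≤ ‖fderiv ℝ f 0‖ * M :=
    ((le_abs_self _).trans ((fderiv ℝ f 0).le_opNorm _)).trans (by gcongr)
  have hq : qForm f w.2.2 ≤ ‖iteratedFDeriv ℝ 2 f 0‖ * M :=
    ((le_abs_self _).trans (abs_qForm_le f _)).trans (by gcongr)
  dsimp only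
  linarith

theorem nonempty_P : S.P.Nonempty := by
  by_contra h
  rw [not_nonempty_iff_eq_empty] at h
  have := S.glevy.init (fun _ => 1) (BddLip.const 1)
  simp [h, slE] at this

theorem slE_increment {f : Rd d → ℝ} (hf : BddLip f) {s r : ℝ} (hs : 0 ≤ s) (hr : 0 ≤ r) :
    slE S.P (fun ω => f (ω.toFun (s + r) - ω.toFun s)) = slE S.P (fun ω => f (ω.toFun r)) :=
  S.glevy.stationary s r hs hr f hf

theorem eventually_mul_lt_slE {f : Rd d → ℝ} (hf : ContDiff ℝ 3 f) (hb : BddLip f) (h0 : f 0 = 0)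
    {c : ℝ} (hc : c < LKgen S.U f) :
    ∀ᶠ t : ℝ in 𝓝[>] 0, c * t < slE S.P (fun ω => f (ω.toFun t)) := by
  filter_upwards [(S.glevy.generator f hf hb.2 h0).eventually (lt_mem_nhds hc),
    self_mem_nhdsWithin] with t ht htpos
  exact (lt_div_iff₀ htpos).1 ht

theorem eventually_slE_lt_mul {f : Rd d → ℝ} (hf : ContDiff ℝ 3 f) (hb : BddLip f) (h0 : f 0 = 0)
    {c : ℝ} (hc : LKgen S.U f < c) :
    ∀ᶠ t : ℝ in 𝓝[>] 0, slE S.P (fun ω => f (ω.toFun t)) < c * t := by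
  filter_upwards [(S.glevy.generator f hf hb.2 h0).eventually (gt_mem_nhds hc),
    self_mem_nhdsWithin] with t ht htpos
  exact (div_lt_iff₀ htpos).1 ht

/-- Measurability of increments: no measurability of the coordinate maps is part of the setting,
but it is forced by the interplay of independence and of the generator.  The pair `a`, `q` of
smooth functions with `q = (a - 1)⁺` serves to detect a measure which does not integrate the
increment. -/
theorem eventually_integrable_increment {a q k : Rd d → ℝ}
    (ha : ContDiff ℝ 3 a) (hal : BddLip a) (ha0 : a 0 = 0) (hanonneg : ∀ x, 0 ≤ a x)
    (hq : ContDiff ℝ 3 q) (hql : BddLip q) (hqa : ∀ x, q x = max 0 (a x - 1))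
    (hqpos : 0 < LKgen S.U q)
    (hk : ContDiff ℝ 3 k) (hkl : BddLip k) (hk0 : k 0 = 0) (hkpos : 0 < LKgen S.U k) :
    ∀ᶠ r : ℝ in 𝓝[>] 0, ∀ s, 0 ≤ s → ∀ μ ∈ S.P,
      Integrable (fun ω : CadPath d => k (ω.toFun (s + r) - ω.toFun s)) μ := by
  have hq0 : q 0 = 0 := by simp [hqa, ha0]
  have hsmall : ∀ᶠ t : ℝ in 𝓝[>] 0, max (LKgen S.U a + 1) 1 * t < 1 := by
    refine nhdsWithin_le_nhds ?_
    refine ContinuousAt.eventually_lt (by fun_prop) continuousAt_const ?_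
    simp
  obtain ⟨t, ht1, ht2, ht3, ht4⟩ := ((S.eventually_mul_lt_slE hq hql hq0 hqpos).and
    ((S.eventually_slE_lt_mul ha hal ha0 (c := max (LKgen S.U a + 1) 1)
      (lt_max_of_lt_left (lt_add_one _))).and
      (hsmall.and self_mem_nhdsWithin))).exists
  have htpos : (0 : ℝ) < t := ht4
  have haE : slE S.P (fun ω => a (ω.toFun t)) < 1 := ht2.trans ht3
  rw [zero_mul] at ht1
  filter_upwards [S.eventually_mul_lt_slE hk hkl hk0 hkpos, self_mem_nhdsWithin] with r hr hr0
  rw [zero_mul] at hr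
  have hrnn : (0 : ℝ) ≤ r := le_of_lt hr0
  intro s hs μ₀ hμ₀
  by_contra hni
  set F := slE S.P (fun ω => k (ω.toFun r)) with hF
  have hshift : ∀ c : ℝ, slE S.P (fun ω => k (ω.toFun (t + r) - ω.toFun t) + c)
      = max 0 (F + c) := by
    intro c
    have hkc : BddLip (fun x => k x + c) := hkl.add (BddLip.const c)
    rw [S.slE_increment hkc htpos.le hrnn, ← S.slE_increment hkc hs hrnn]
    have := slE_add_const_of_not_integrable S.prob
      (hkl.bdd_comp fun ω : CadPath d => ω.toFun (s + r) - ω.toFun s)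
      (by rwa [S.slE_increment hkl hs hrnn]) hμ₀ hni c
    rwa [S.slE_increment hkl hs hrnn] at this
  have hlip : ∀ c : ℝ, BddLip (fun p : (Fin 1 → Rd d) × Rd d => a (p.1 0) + c + (k p.2 - F)) := by
    intro c
    have h1 : BddLip (fun p : (Fin 1 → Rd d) × Rd d => a (p.1 0)) :=
      hal.comp ((LipschitzWith.eval (0 : Fin 1)).comp LipschitzWith.prod_fst)
    have h2 : BddLip (fun p : (Fin 1 → Rd d) × Rd d => k p.2) := hkl.comp LipschitzWith.prod_snd
    exact (h1.add (BddLip.const c)).add (by simpa [sub_eq_add_neg] using h2.add (BddLip.const (-F)))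
  have hind : ∀ c : ℝ, slE S.P (fun ω => a (ω.toFun t) + c +
      (k (ω.toFun (t + r) - ω.toFun t) - F)) = slE S.P (fun ω => max 0 (a (ω.toFun t) + c)) := by
    intro c
    have := S.glevy.indep 1 (fun _ => t) t r (fun _ => htpos.le) (fun _ => le_rfl) hrnn _ (hlip c)
    refine this.trans (congrArg (slE S.P) (funext fun ω => ?_))
    have h := hshift (a (ω.toFun t) + c - F)
    rw [add_sub_cancel] at h
    rw [← h]
    exact congrArg (slE S.P) (funext fun ω' => by ring)
  have h1 : 0 < slE S.P (fun ω => a (ω.toFun t) + (-1) +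
      (k (ω.toFun (t + r) - ω.toFun t) - F)) := by
    rw [hind]
    simpa [hqa, sub_eq_add_neg] using ht1
  obtain ⟨μ, hμ, hlt⟩ := exists_lt_integral_of_lt_slE S.nonempty_P h1
  have := S.prob μ hμ
  have hi : Integrable (fun ω : CadPath d => a (ω.toFun t) + (-1) +
      (k (ω.toFun (t + r) - ω.toFun t) - F)) μ := by
    by_contra hcon
    rw [integral_undef hcon] at hlt
    exact lt_irrefl _ hlt
  have h2 : ∫ ω, (a (ω.toFun t) + 0 + (k (ω.toFun (t + r) - ω.toFun t) - F)) ∂μ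
      = ∫ ω, (a (ω.toFun t) + (-1) + (k (ω.toFun (t + r) - ω.toFun t) - F)) ∂μ + 1 := by
    have := integral_add hi (integrable_const (1 : ℝ))
    simp only [integral_const, probReal_univ, one_smul] at this
    rw [← this]
    exact integral_congr_ae (ae_of_all _ fun ω => by ring)
  have h3 := integral_le_slE S.prob ((hlip 0).bdd_comp fun ω : CadPath d =>
    ((fun _ => ω.toFun t : Fin 1 → Rd d), ω.toFun (t + r) - ω.toFun t)) hμ
  have h4 := hind 0
  simp only [add_zero, max_eq_right (hanonneg _)] at h4 h3 h2
  rw [h4] at h3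
  linarith

end Setting

theorem Real.lipschitzWith_arctan : LipschitzWith 1 Real.arctan := by
  refine lipschitzWith_of_nnnorm_deriv_le Real.differentiable_arctan fun x => ?_
  rw [← NNReal.coe_le_coe, coe_nnnorm, Real.deriv_arctan, Real.norm_eq_abs,
    abs_of_nonneg (by positivity), NNReal.coe_one]
  exact div_le_one_of_le₀ (by nlinarith [sq_nonneg x]) (by positivity)

theorem bddLip_arctan_coord {d : ℕ} (i : Fin d) : BddLip (fun x : Rd d => Real.arctan (x i)) := by
  refine ⟨⟨_, Real.lipschitzWith_arctan.comp (EuclideanSpace.proj (𝕜 := ℝ) i).lipschitz⟩,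
    Real.pi / 2, fun x => ?_⟩
  exact abs_le.2 ⟨(Real.neg_pi_div_two_lt_arctan _).le, (Real.arctan_lt_pi_div_two _).le⟩

theorem contDiff_arctan_coord {d : ℕ} (i : Fin d) {n : WithTop ℕ∞} :
    ContDiff ℝ n (fun x : Rd d => Real.arctan (x i)) :=
  Real.contDiff_arctan.comp (EuclideanSpace.proj (𝕜 := ℝ) i).contDiff

theorem aemeasurable_of_arctan_coord {Ωs : Type*} [MeasurableSpace Ωs] {μ : Measure Ωs} {d : ℕ}
    {Y : Ωs → Rd d} (h : ∀ i, AEMeasurable (fun ω => Real.arctan (Y ω i)) μ) :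
    AEMeasurable Y μ := by
  have htan : Measurable Real.tan := by
    have : Real.tan = fun x => Real.sin x / Real.cos x := funext Real.tan_eq_sin_div_cos
    rw [this]
    exact Real.measurable_sin.div Real.measurable_cos
  have hi : ∀ i, AEMeasurable (fun ω => Y ω i) μ := fun i => by
    simpa [Function.comp_def, Real.tan_arctan] using htan.comp_aemeasurable (h i)
  exact (WithLp.measurable_toLp 2 (Fin d → ℝ)).comp_aemeasurable (aemeasurable_pi_lambda _ hi)

namespace Setting

variable {d : ℕ} [TopologicalSpace (CadPath d)] [MeasurableSpace (CadPath d)] (S : Setting d)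

theorem eventually_aemeasurable_increment {a q : Rd d → ℝ}
    (ha : ContDiff ℝ 3 a) (hal : BddLip a) (ha0 : a 0 = 0) (hanonneg : ∀ x, 0 ≤ a x)
    (hq : ContDiff ℝ 3 q) (hql : BddLip q) (hqa : ∀ x, q x = max 0 (a x - 1))
    {u : LKparam d} (hu : u ∈ S.U) (hqpos : 0 < LKval q u) :
    ∀ᶠ r : ℝ in 𝓝[>] 0, ∀ s, 0 ≤ s → ∀ μ ∈ S.P,
      AEMeasurable (fun ω : CadPath d => ω.toFun (s + r) - ω.toFun s) μ := by
  have hq0 : q 0 = 0 := by simp [hqa, ha0]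
  have hqgen : 0 < LKgen S.U q := hqpos.trans_le (S.LKval_le_LKgen hql hq0 hu)
  have key : ∀ i : Fin d, ∃ c : ℝ, 0 < c ∧ ∀ᶠ r : ℝ in 𝓝[>] 0, ∀ s, 0 ≤ s → ∀ μ ∈ S.P,
      Integrable (fun ω : CadPath d => q (ω.toFun (s + r) - ω.toFun s) +
        c * Real.arctan ((ω.toFun (s + r) - ω.toFun s) i)) μ := by
    intro i
    set L := LKval (fun x : Rd d => Real.arctan (x i)) u with hL
    have hden : 0 < 2 * (|L| + 1) := by positivity
    refine ⟨LKval q u / (2 * (|L| + 1)), by positivity, ?_⟩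
    set c := LKval q u / (2 * (|L| + 1)) with hc
    have hcpos : 0 < c := by positivity
    have hcL : c * (2 * (|L| + 1)) = LKval q u := div_mul_cancel₀ _ hden.ne'
    have hlip : BddLip (fun x : Rd d => q x + c * Real.arctan (x i)) :=
      hql.add ((BddLip.const c).mul (bddLip_arctan_coord i))
    have h0 : q (0 : Rd d) + c * Real.arctan ((0 : Rd d) i) = 0 := by simp [hq0]
    refine S.eventually_integrable_increment ha hal ha0 hanonneg hq hql hqa hqgen
      (k := fun x : Rd d => q x + c * Real.arctan (x i))
      (hq.add (contDiff_const.mul (contDiff_arctan_coord i))) hlip h0 ?_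
    refine lt_of_lt_of_le ?_ (S.LKval_le_LKgen hlip h0 hu)
    rw [LKval_add_const_mul (S.lintegral_norm_ne_top hu) hq (contDiff_arctan_coord i) hql
      (bddLip_arctan_coord i) hq0 (by simp) c, ← hL]
    nlinarith [neg_abs_le L, abs_nonneg L]
  choose c hc hev using key
  filter_upwards [eventually_all.2 hev,
    S.eventually_integrable_increment ha hal ha0 hanonneg hq hql hqa hqgen hq hql hq0 hqgen]
    with r hr hr' s hs μ hμ
  refine aemeasurable_of_arctan_coord fun i => ?_
  have h := (((hr i s hs μ hμ).sub (hr' s hs μ hμ)).const_mul (c i)⁻¹).aemeasurable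
  refine h.congr (ae_of_all _ fun ω => ?_)
  simp [(hc i).ne']

end Setting

section FirstExit

variable {Ωs E : Type*} [NormedAddCommGroup E]

/-- The event that `D` exits the ball of radius `η` around `D m` for the first time (after
time `m`) at time `k`. -/
def firstExit (D : ℕ → Ωs → E) (η : ℝ) (m k : ℕ) : Set Ωs :=
  {ω | η ≤ ‖D k ω - D m ω‖ ∧ ∀ j, m ≤ j → j < k → ‖D j ω - D m ω‖ < η}

theorem exists_mem_firstExit {D : ℕ → Ωs → E} {η : ℝ} {m n : ℕ} {ω : Ωs}
    (h : ∃ k, m ≤ k ∧ k ≤ n ∧ η ≤ ‖D k ω - D m ω‖) :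
    ∃ k, m ≤ k ∧ k ≤ n ∧ ω ∈ firstExit D η m k := by
  classical
  have h' : ∃ k, m ≤ k ∧ η ≤ ‖D k ω - D m ω‖ := h.imp fun k hk => ⟨hk.1, hk.2.2⟩
  obtain ⟨k, hk1, hk2, hk3⟩ := h
  refine ⟨Nat.find h', (Nat.find_spec h').1, (Nat.find_min' h' ⟨hk1, hk3⟩).trans hk2,
    (Nat.find_spec h').2, fun j hmj hj => ?_⟩
  have := Nat.find_min h' hj
  push Not at this
  exact this hmj

theorem disjoint_firstExit (D : ℕ → Ωs → E) (η : ℝ) (m : ℕ) {i k : ℕ} (hi : m ≤ i) (hk : m ≤ k)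
    (hik : i ≠ k) : Disjoint (firstExit D η m i) (firstExit D η m k) := by
  rw [Set.disjoint_left]
  rintro ω ⟨h1, h2⟩ ⟨h3, h4⟩
  rcases lt_or_gt_of_ne hik with h | h
  · exact absurd (h4 i hi h) (not_lt.2 h1)
  · exact absurd (h2 k hk h) (not_lt.2 h3)

/-- A path with small increments away from `z` which ends up near `z` exits twice. -/
theorem exists_two_exits {D : ℕ → Ωs → E} {ω : Ωs} {z : E} {ρ η : ℝ} {n : ℕ} (hη : 0 < η)
    (hηρ : 2 * η ≤ ρ) (hz : 4 * ρ ≤ ‖z‖) (h0 : D 0 ω = 0) (hn : D n ω ∈ Metric.ball z ρ)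
    (hinc : ∀ j < n, D (j + 1) ω - D j ω ∉ Metric.closedBall z (2 * ρ)) :
    ∃ i ≤ n, ω ∈ firstExit D η 0 i ∧ ∃ k, i ≤ k ∧ k ≤ n ∧ η ≤ ‖D k ω - D i ω‖ := by
  rw [mem_ball_iff_norm] at hn
  have hDn : η ≤ ‖D n ω - D 0 ω‖ := by
    rw [h0, sub_zero]
    have := norm_sub_norm_le z (D n ω)
    rw [norm_sub_rev] at this
    linarith
  obtain ⟨i, -, hi, hexit⟩ := exists_mem_firstExit ⟨n, Nat.zero_le n, le_rfl, hDn⟩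
  refine ⟨i, hi, hexit, n, hi, le_rfl, ?_⟩
  obtain ⟨j, rfl⟩ : ∃ j, i = j + 1 := by
    refine Nat.exists_eq_succ_of_ne_zero ?_
    rintro rfl
    have := hexit.1
    simp only [sub_self, norm_zero] at this
    linarith
  have hj := hexit.2 j (Nat.zero_le j) (Nat.lt_succ_self j)
  rw [h0, sub_zero] at hj
  by_contra! hlt
  refine hinc j hi ?_
  rw [mem_closedBall_iff_norm]
  have e : D (j + 1) ω - D j ω - z = (D n ω - z) - (D n ω - D (j + 1) ω) - D j ω := by abel
  rw [e]
  refine (norm_sub_le _ _).trans ?_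
  have := norm_sub_le (D n ω - z) (D n ω - D (j + 1) ω)
  linarith

variable {m0 : MeasurableSpace Ωs} {μ : Measure Ωs} [MeasurableSpace E] [BorelSpace E]
  [SecondCountableTopology E]

theorem measurableSet_firstExit {D : ℕ → Ωs → E} (η : ℝ) {m k : ℕ} (hmk : m ≤ k)
    {mk : MeasurableSpace Ωs} (hD : ∀ j ≤ k, Measurable[mk] (D j)) :
    MeasurableSet[mk] (firstExit D η m k) := by
  have hn : ∀ j ≤ k, Measurable[mk] (fun ω => ‖D j ω - D m ω‖) := fun j hj =>
    ((hD j hj).sub (hD m hmk)).norm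
  have : firstExit D η m k = {ω | η ≤ ‖D k ω - D m ω‖} ∩
      ⋂ j ∈ Finset.Ico m k, {ω | ‖D j ω - D m ω‖ < η} := by
    ext ω
    simp [firstExit]
  rw [this]
  refine (measurableSet_le measurable_const (hn k le_rfl)).inter
    (Finset.measurableSet_biInter _ fun j hj => ?_)
  exact measurableSet_lt (hn j (Finset.mem_Ico.1 hj).2.le) measurable_const

/-- A maximal inequality of Ottaviani type. -/
theorem measure_inter_exists_le {D : ℕ → Ωs → E} {F : ℕ → MeasurableSpace Ωs} (hF : Monotone F)
    (hF0 : ∀ k, F k ≤ m0) {n : ℕ} (hD : ∀ k ≤ n, Measurable[F k] (D k)) {η : ℝ} {ε : ℝ≥0∞}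
    (H : ∀ m ≤ n, ∀ A, MeasurableSet[F m] A →
      μ (A ∩ {ω | η / 2 ≤ ‖D n ω - D m ω‖}) ≤ ε * μ A)
    {m : ℕ} (hm : m ≤ n) {A : Set Ωs} (hA : MeasurableSet[F m] A) :
    μ (A ∩ {ω | ∃ k, m ≤ k ∧ k ≤ n ∧ η ≤ ‖D k ω - D m ω‖}) ≤ 2 * ε * μ A := by
  set Ak : ℕ → Set Ωs := fun k => A ∩ firstExit D η m k with hAk
  have hmeas : ∀ k ∈ Finset.Icc m n, MeasurableSet[F k] (Ak k) := by
    intro k hk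
    rw [Finset.mem_Icc] at hk
    exact (hF hk.1 _ hA).inter (measurableSet_firstExit η hk.1 fun j hj =>
      (hD j (hj.trans hk.2)).mono (hF hj) le_rfl)
  have hsum : ∑ k ∈ Finset.Icc m n, μ (Ak k) ≤ μ A := by
    rw [← measure_biUnion_finset]
    · exact measure_mono (iUnion₂_subset fun k _ => inter_subset_left)
    · intro i hi k hk hik
      exact (disjoint_firstExit D η m (Finset.mem_Icc.1 hi).1 (Finset.mem_Icc.1 hk).1 hik).mono
        inter_subset_right inter_subset_right
    · exact fun k hk => hF0 k _ (hmeas k hk)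
  have hsub : A ∩ {ω | ∃ k, m ≤ k ∧ k ≤ n ∧ η ≤ ‖D k ω - D m ω‖} ⊆
      (A ∩ {ω | η / 2 ≤ ‖D n ω - D m ω‖}) ∪
        ⋃ k ∈ Finset.Icc m n, Ak k ∩ {ω | η / 2 ≤ ‖D n ω - D k ω‖} := by
    rintro ω ⟨hωA, hω⟩
    obtain ⟨k, hmk, hkn, hk⟩ := exists_mem_firstExit hω
    by_cases hc : η / 2 ≤ ‖D n ω - D m ω‖
    · exact Or.inl ⟨hωA, hc⟩
    · refine Or.inr (mem_iUnion₂.2 ⟨k, Finset.mem_Icc.2 ⟨hmk, hkn⟩, ⟨hωA, hk⟩, ?_⟩)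
      have h1 := norm_sub_le_norm_sub_add_norm_sub (D k ω) (D n ω) (D m ω)
      rw [norm_sub_rev (D k ω) (D n ω)] at h1
      have h2 := hk.1
      push Not at hc
      change η / 2 ≤ ‖D n ω - D k ω‖
      linarith
  calc _ ≤ μ (A ∩ {ω | η / 2 ≤ ‖D n ω - D m ω‖}) +
        ∑ k ∈ Finset.Icc m n, μ (Ak k ∩ {ω | η / 2 ≤ ‖D n ω - D k ω‖}) :=
      (measure_mono hsub).trans ((measure_union_le _ _).trans
        (add_le_add le_rfl (measure_biUnion_finset_le _ _)))
    _ ≤ ε * μ A + ∑ k ∈ Finset.Icc m n, ε * μ (Ak k) :=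
      add_le_add (H m hm A hA) (Finset.sum_le_sum fun k hk =>
        H k (Finset.mem_Icc.1 hk).2 _ (hmeas k hk))
    _ ≤ ε * μ A + ε * μ A := by
      rw [← Finset.mul_sum]
      gcongr
    _ = 2 * ε * μ A := by ring

/-- The probability of two successive exits is of second order. -/
theorem measure_two_exits_le [IsProbabilityMeasure μ] {D : ℕ → Ωs → E}
    {F : ℕ → MeasurableSpace Ωs} (hF : Monotone F)
    (hF0 : ∀ k, F k ≤ m0) {n : ℕ} (hD : ∀ k ≤ n, Measurable[F k] (D k)) {η : ℝ} {ε : ℝ≥0∞}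
    (H : ∀ m ≤ n, ∀ A, MeasurableSet[F m] A →
      μ (A ∩ {ω | η / 2 ≤ ‖D n ω - D m ω‖}) ≤ ε * μ A) :
    μ {ω | ∃ i ≤ n, ω ∈ firstExit D η 0 i ∧ ∃ k, i ≤ k ∧ k ≤ n ∧ η ≤ ‖D k ω - D i ω‖} ≤
      4 * ε ^ 2 := by
  have hmeas : ∀ k ∈ Finset.Icc 0 n, MeasurableSet[F k] (firstExit D η 0 k) := fun k hk =>
    measurableSet_firstExit η (Nat.zero_le k) fun j hj =>
      (hD j (hj.trans (Finset.mem_Icc.1 hk).2)).mono (hF hj) le_rfl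
  have hsum : ∑ k ∈ Finset.Icc 0 n, μ (firstExit D η 0 k) ≤ 2 * ε := by
    rw [← measure_biUnion_finset]
    · have := measure_inter_exists_le hF hF0 hD H (Nat.zero_le n) MeasurableSet.univ
      rw [measure_univ, mul_one, univ_inter] at this
      refine (measure_mono (iUnion₂_subset fun k hk ω hω => ?_)).trans this
      exact ⟨k, Nat.zero_le k, (Finset.mem_Icc.1 hk).2, hω.1⟩
    · intro i hi k hk hik
      exact disjoint_firstExit D η 0 (Nat.zero_le i) (Nat.zero_le k) hik
    · exact fun k hk => hF0 k _ (hmeas k hk)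
  calc _ ≤ μ (⋃ i ∈ Finset.Icc 0 n, firstExit D η 0 i ∩
        {ω | ∃ k, i ≤ k ∧ k ≤ n ∧ η ≤ ‖D k ω - D i ω‖}) := by
        refine measure_mono ?_
        rintro ω ⟨i, hi, h1, h2⟩
        exact mem_iUnion₂.2 ⟨i, Finset.mem_Icc.2 ⟨Nat.zero_le i, hi⟩, h1, h2⟩
    _ ≤ ∑ i ∈ Finset.Icc 0 n, 2 * ε * μ (firstExit D η 0 i) :=
      (measure_biUnion_finset_le _ _).trans (Finset.sum_le_sum fun i hi =>
        measure_inter_exists_le hF hF0 hD H (Finset.mem_Icc.1 hi).2 (hmeas i hi))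
    _ ≤ 2 * ε * (2 * ε) := by
      rw [← Finset.mul_sum]
      gcongr
    _ = 4 * ε ^ 2 := by ring

end FirstExit

/-- Integral domination tested against bounded Lipschitz functions of `Z` yields domination on
the events generated by `Z`. -/
theorem setLIntegral_preimage_le {Ωs E : Type*} [MeasurableSpace Ωs] [MetricSpace E]
    [MeasurableSpace E] [BorelSpace E] {μ : Measure Ωs} [IsFiniteMeasure μ] {Z : Ωs → E}
    (hZ : AEMeasurable Z μ) {ψ : Ωs → ℝ} (hψ : AEMeasurable ψ μ) (h0 : ∀ ω, 0 ≤ ψ ω)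
    (h1 : ∀ ω, ψ ω ≤ 1) {e : ℝ}
    (H : ∀ a : E → ℝ, BddLip a → (∀ x, 0 ≤ a x) →
      ∫ ω, a (Z ω) * ψ ω ∂μ ≤ e * ∫ ω, a (Z ω) ∂μ)
    {B : Set E} (hB : MeasurableSet B) :
    ∫⁻ ω in Z ⁻¹' B, ENNReal.ofReal (ψ ω) ∂μ ≤ ENNReal.ofReal e * μ (Z ⁻¹' B) := by
  set w : Ωs → ℝ≥0∞ := fun ω => ENNReal.ofReal (ψ ω) with hw
  have hwm : AEMeasurable w μ := hψ.ennreal_ofReal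
  have hZ' : AEMeasurable Z (μ.withDensity w) :=
    hZ.mono_ac (withDensity_absolutelyContinuous _ _)
  have hwfin : ∫⁻ ω, w ω ∂μ ≠ ⊤ := by
    refine ne_top_of_le_ne_top (measure_ne_top μ univ) ?_
    rw [← lintegral_one]
    exact lintegral_mono fun ω => ENNReal.ofReal_le_one.2 (h1 ω)
  have := isFiniteMeasure_withDensity hwfin
  set ν₁ := (μ.withDensity w).map Z with hν₁
  set ν₂ := μ.map Z with hν₂
  have hclosed : ∀ C : Set E, IsClosed C → ν₁ C ≤ ENNReal.ofReal e * ν₂ C := by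
    intro C hC
    have hpos : ∀ n : ℕ, (0 : ℝ) < 1 / ((n : ℝ) + 1) := fun n => Nat.one_div_pos_of_nat
    have hlim := tendsto_one_div_add_atTop_nhds_zero_nat (𝕜 := ℝ)
    refine le_of_tendsto_of_tendsto'
      (tendsto_lintegral_thickenedIndicator_of_isClosed ν₁ hC hpos hlim)
      (ENNReal.Tendsto.const_mul (tendsto_lintegral_thickenedIndicator_of_isClosed ν₂ hC hpos hlim)
        (Or.inr ENNReal.ofReal_ne_top)) fun n => ?_
    set θ := thickenedIndicator (hpos n) C with hθ
    have hθm : Measurable (fun x => (θ x : ℝ≥0∞)) :=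
      θ.continuous.measurable.coe_nnreal_ennreal
    have hθb : ∀ x, (θ x : ℝ) ≤ 1 := fun x => thickenedIndicator_le_one (hpos n) C x
    have hθl : BddLip (fun x => (θ x : ℝ)) := by
      refine ⟨⟨_, lipschitzWith_thickenedIndicator (hpos n) C⟩, 1, fun x => ?_⟩
      rw [abs_of_nonneg (NNReal.coe_nonneg _)]
      exact hθb x
    have hθZ : AEMeasurable (fun ω => (θ (Z ω) : ℝ)) μ :=
      (measurable_coe_nnreal_real.comp θ.continuous.measurable).comp_aemeasurable hZ
    have hi1 : Integrable (fun ω => (θ (Z ω) : ℝ)) μ :=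
      Integrable.of_bound hθZ.aestronglyMeasurable 1 (ae_of_all _ fun ω => by
        rw [Real.norm_eq_abs, abs_of_nonneg (NNReal.coe_nonneg _)]
        exact hθb _)
    have hi2 : Integrable (fun ω => (θ (Z ω) : ℝ) * ψ ω) μ :=
      Integrable.of_bound (hθZ.mul hψ).aestronglyMeasurable 1 (ae_of_all _ fun ω => by
        rw [Real.norm_eq_abs, abs_of_nonneg (mul_nonneg (NNReal.coe_nonneg _) (h0 ω))]
        exact mul_le_one₀ (hθb _) (h0 ω) (h1 ω))
    have e1 : ∫⁻ x, θ x ∂ν₁ = ENNReal.ofReal (∫ ω, (θ (Z ω) : ℝ) * ψ ω ∂μ) := by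
      rw [hν₁, lintegral_map' hθm.aemeasurable hZ',
        lintegral_withDensity_eq_lintegral_mul₀ hwm (g := fun ω => (θ (Z ω) : ℝ≥0∞)) (hθm.comp_aemeasurable hZ),
        ofReal_integral_eq_lintegral_ofReal hi2
          (ae_of_all _ fun ω => mul_nonneg (NNReal.coe_nonneg _) (h0 ω))]
      refine lintegral_congr fun ω => ?_
      rw [ENNReal.ofReal_mul (NNReal.coe_nonneg _), ENNReal.ofReal_coe_nnreal, mul_comm]
      rfl
    have e2 : ∫⁻ x, θ x ∂ν₂ = ENNReal.ofReal (∫ ω, (θ (Z ω) : ℝ) ∂μ) := by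
      rw [hν₂, lintegral_map' hθm.aemeasurable hZ, ofReal_integral_eq_lintegral_ofReal hi1
        (ae_of_all _ fun ω => NNReal.coe_nonneg _)]
      simp only [ENNReal.ofReal_coe_nnreal]
    rw [e1, e2, ← ENNReal.ofReal_mul' (integral_nonneg fun ω => NNReal.coe_nonneg _)]
    exact ENNReal.ofReal_le_ofReal (H _ hθl fun x => NNReal.coe_nonneg _)
  have hBm : ν₁ B ≤ ENNReal.ofReal e * ν₂ B := by
    rw [hB.measure_eq_iSup_isClosed_of_ne_top (measure_ne_top ν₁ B)]
    refine iSup₂_le fun C hCB => iSup_le fun hC => (hclosed C hC).trans ?_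
    gcongr
  rwa [hν₁, hν₂, Measure.map_apply_of_aemeasurable hZ' hB, Measure.map_apply_of_aemeasurable hZ hB,
    withDensity_apply'] at hBm

namespace Setting

variable {d : ℕ} [TopologicalSpace (CadPath d)] [MeasurableSpace (CadPath d)] (S : Setting d)

/-- Conditionally on the past, the law of an increment is dominated by its upper expectation. -/
theorem setLIntegral_increment_le {g : Rd d → ℝ} (hg : BddLip g) (hg0 : ∀ x, 0 ≤ g x)
    (hg1 : ∀ x, g x ≤ 1) {s r : ℝ} (hs : 0 ≤ s) (hr : 0 ≤ r)
    (hinc : ∀ μ ∈ S.P, AEMeasurable (fun ω : CadPath d => ω.toFun (s + r) - ω.toFun s) μ)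
    {m : ℕ} {t : Fin (m + 1) → ℝ} (ht0 : ∀ i, 0 ≤ t i) (hts : ∀ i, t i ≤ s)
    {μ : Measure (CadPath d)} (hμ : μ ∈ S.P)
    (hZ : AEMeasurable (fun (ω : CadPath d) i => ω.toFun (t i) - ω.toFun (t 0)) μ)
    {B : Set (Fin (m + 1) → Rd d)} (hB : MeasurableSet B) :
    ∫⁻ ω in (fun (ω : CadPath d) i => ω.toFun (t i) - ω.toFun (t 0)) ⁻¹' B,
        ENNReal.ofReal (g (ω.toFun (s + r) - ω.toFun s)) ∂μ ≤
      ENNReal.ofReal (slE S.P (fun ω => g (ω.toFun r))) *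
        μ ((fun (ω : CadPath d) i => ω.toFun (t i) - ω.toFun (t 0)) ⁻¹' B) := by
  have := S.prob μ hμ
  obtain ⟨K, hK⟩ := hg.1
  have hgm : ∀ ν ∈ S.P, AEMeasurable
      (fun ω : CadPath d => g (ω.toFun (s + r) - ω.toFun s)) ν := fun ν hν =>
    hK.continuous.measurable.comp_aemeasurable (hinc ν hν)
  have hgi : ∀ ν ∈ S.P, Integrable
      (fun ω : CadPath d => g (ω.toFun (s + r) - ω.toFun s)) ν := fun ν hν => by
    have := S.prob ν hν
    refine Integrable.of_bound (hgm ν hν).aestronglyMeasurable 1 (ae_of_all _ fun ω => ?_)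
    rw [Real.norm_eq_abs, abs_of_nonneg (hg0 _)]
    exact hg1 _
  refine setLIntegral_preimage_le hZ (hgm μ hμ) (fun _ => hg0 _) (fun _ => hg1 _) ?_ hB
  intro a ha ha0
  set e := slE S.P (fun ω => g (ω.toFun r)) with he
  have hee : slE S.P (fun ω => g (ω.toFun (s + r) - ω.toFun s)) = e := S.slE_increment hg hs hr
  set Λ : (Fin (m + 1) → Rd d) →L[ℝ] (Fin (m + 1) → Rd d) := ContinuousLinearMap.pi fun i =>
    ContinuousLinearMap.proj (R := ℝ) (φ := fun _ : Fin (m + 1) => Rd d) i -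
      ContinuousLinearMap.proj (R := ℝ) (φ := fun _ : Fin (m + 1) => Rd d) 0 with hΛ
  have hφ : BddLip (fun p : (Fin (m + 1) → Rd d) × Rd d => a (Λ p.1) * (g p.2 + -e)) :=
    (ha.comp (Λ.lipschitz.comp LipschitzWith.prod_fst)).mul
      ((hg.comp LipschitzWith.prod_snd).add (BddLip.const (-e)))
  have hind := S.glevy.indep (m + 1) t s r ht0 hts hr _ hφ
  have hinner : ∀ ω : CadPath d, slE S.P (fun ω' : CadPath d =>
      a (Λ fun i => ω.toFun (t i)) * (g (ω'.toFun (s + r) - ω'.toFun s) + -e)) = 0 := by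
    intro ω
    rw [slE_const_mul (ha0 _)]
    have := slE_sub_self S.prob S.nonempty_P
      (hg.bdd_comp fun ω' : CadPath d => ω'.toFun (s + r) - ω'.toFun s) hgi
    rw [hee] at this
    simp only [← sub_eq_add_neg, this, mul_zero]
  simp only [hinner] at hind
  have hle := integral_le_slE S.prob (hφ.bdd_comp fun ω : CadPath d =>
    ((fun i => ω.toFun (t i)), ω.toFun (s + r) - ω.toFun s)) hμ
  rw [hind] at hle
  have hzero : slE S.P (fun _ : CadPath d => (0 : ℝ)) ≤ 0 :=
    slE_le S.nonempty_P fun ν _ => by simp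
  obtain ⟨L, hL⟩ := ha.1
  obtain ⟨C, hC⟩ := ha.2
  have ham : AEMeasurable (fun ω : CadPath d => a (fun i => ω.toFun (t i) - ω.toFun (t 0))) μ :=
    hL.continuous.measurable.comp_aemeasurable hZ
  have hai : Integrable (fun ω : CadPath d => a (fun i => ω.toFun (t i) - ω.toFun (t 0))) μ :=
    Integrable.of_bound ham.aestronglyMeasurable C (ae_of_all _ fun ω => hC _)
  have hagi : Integrable (fun ω : CadPath d => a (fun i => ω.toFun (t i) - ω.toFun (t 0)) *
      g (ω.toFun (s + r) - ω.toFun s)) μ :=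
    hai.mul_bdd (c := 1) (hgm μ hμ).aestronglyMeasurable (ae_of_all _ fun ω => by
      rw [Real.norm_eq_abs, abs_of_nonneg (hg0 _)]
      exact hg1 _)
  have hsplit : ∫ ω : CadPath d, a (Λ fun i => ω.toFun (t i)) *
      (g (ω.toFun (s + r) - ω.toFun s) + -e) ∂μ =
      ∫ ω : CadPath d, a (fun i => ω.toFun (t i) - ω.toFun (t 0)) *
        g (ω.toFun (s + r) - ω.toFun s) ∂μ -
      e * ∫ ω : CadPath d, a (fun i => ω.toFun (t i) - ω.toFun (t 0)) ∂μ := by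
    rw [← integral_const_mul, ← integral_sub hagi (hai.const_mul e)]
    refine integral_congr_ae (ae_of_all _ fun ω => ?_)
    change a (fun i => ω.toFun (t i) - ω.toFun (t 0)) * _ = _
    ring
  linarith

/-- Over a short time interval, the probability of two successive exits is of second order. -/
theorem measure_two_exits_le {g : Rd d → ℝ} (hg : BddLip g) (hg0 : ∀ x, 0 ≤ g x)
    (hg1 : ∀ x, g x ≤ 1) {η : ℝ} (hη : 0 < η) (hgη : ∀ x, η / 2 ≤ ‖x‖ → g x = 1) {δ ε : ℝ}
    (hδ : 0 < δ)
    (hmeas : ∀ r ∈ Ioc 0 δ, ∀ s, 0 ≤ s → ∀ μ ∈ S.P,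
      AEMeasurable (fun ω : CadPath d => ω.toFun (s + r) - ω.toFun s) μ)
    (hε : ∀ r ∈ Ioc 0 δ, slE S.P (fun ω => g (ω.toFun r)) ≤ ε)
    {μ : Measure (CadPath d)} (hμ : μ ∈ S.P) {n : ℕ} (hn : 0 < n) :
    μ {ω | ∃ i ≤ n, ω ∈ firstExit (fun (j : ℕ) (ω : CadPath d) =>
        ω.toFun (j * (δ / n)) - ω.toFun 0) η 0 i ∧ ∃ k, i ≤ k ∧ k ≤ n ∧
        η ≤ ‖(ω.toFun (k * (δ / n)) - ω.toFun 0) - (ω.toFun (i * (δ / n)) - ω.toFun 0)‖} ≤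
      4 * ENNReal.ofReal ε ^ 2 := by
  have := S.prob μ hμ
  set D : ℕ → CadPath d → Rd d := fun j ω => ω.toFun (j * (δ / n)) - ω.toFun 0 with hDdef
  have hn' : (0 : ℝ) < n := by exact_mod_cast hn
  have hstep : 0 < δ / n := div_pos hδ hn'
  have hnδ : n * (δ / n) = δ := mul_div_cancel₀ _ hn'.ne'
  have hD : ∀ j, AEMeasurable (D (min j n)) μ := by
    intro j
    rcases Nat.eq_zero_or_pos (min j n) with h | h
    · rw [h]
      simp only [hDdef, Nat.cast_zero, zero_mul, sub_self]
      exact aemeasurable_const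
    · have h1 : ((min j n : ℕ) : ℝ) * (δ / n) ∈ Ioc 0 δ := by
        refine ⟨mul_pos (by exact_mod_cast h) hstep, ?_⟩
        calc ((min j n : ℕ) : ℝ) * (δ / n) ≤ n * (δ / n) := by
              gcongr
              exact min_le_right _ _
          _ = δ := hnδ
      have := hmeas _ h1 0 le_rfl μ hμ
      simpa only [zero_add] using this
  set D' : ℕ → CadPath d → Rd d := fun j => (hD j).mk with hD'def
  have hD'm : ∀ j, Measurable (D' j) := fun j => (hD j).measurable_mk
  have hae : ∀ᵐ ω ∂μ, ∀ j ≤ n, D j ω = D' j ω := by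
    have : ∀ᵐ ω ∂μ, ∀ j, D (min j n) ω = D' j ω := ae_all_iff.2 fun j => (hD j).ae_eq_mk
    filter_upwards [this] with ω hω j hj
    rw [← hω j, min_eq_left hj]
  have key := _root_.measure_two_exits_le (μ := μ) (D := D') (n := n) (η := η)
    (ε := ENNReal.ofReal ε)
    (F := fun m => MeasurableSpace.comap (fun ω (i : Fin (m + 1)) => D' i ω) MeasurableSpace.pi)
    ?_ ?_ ?_ ?_
  · refine le_trans (measure_mono_ae ?_) key
    filter_upwards [hae] with ω hω
    rintro ⟨i, hi, ⟨h1, h2⟩, k, hik, hkn, h3⟩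
    refine ⟨i, hi, ⟨?_, fun j _ hj => ?_⟩, k, hik, hkn, ?_⟩
    · rw [← hω i hi, ← hω 0 (Nat.zero_le n)]
      exact h1
    · rw [← hω j (hj.le.trans hi), ← hω 0 (Nat.zero_le n)]
      exact h2 j (Nat.zero_le j) hj
    · rw [← hω i hi, ← hω k hkn]
      exact h3
  · intro m k hmk
    have hk : Measurable[MeasurableSpace.comap (fun ω (i : Fin (k + 1)) => D' i ω)
        MeasurableSpace.pi] (fun ω (i : Fin (k + 1)) => D' i ω) := comap_measurable _
    refine Measurable.comap_le (@measurable_pi_lambda _ _ _ (_) _ _ fun i => ?_)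
    exact (measurable_pi_apply (⟨i, by omega⟩ : Fin (k + 1))).comp hk
  · exact fun k => Measurable.comap_le (measurable_pi_lambda _ fun i => hD'm i)
  · exact fun k _ => (measurable_pi_apply (Fin.last k)).comp
      (comap_measurable fun ω (i : Fin (k + 1)) => D' i ω)
  · rintro m hm _ ⟨B, hB, rfl⟩
    rcases hm.eq_or_lt with rfl | hlt
    · have : {ω | η / 2 ≤ ‖D' m ω - D' m ω‖} = ∅ := by
        ext ω
        simp [hη]
      rw [this, inter_empty, measure_empty]
      exact zero_le
    set t : Fin (m + 1) → ℝ := fun i => i * (δ / n) with ht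
    set s : ℝ := m * (δ / n) with hs
    set r : ℝ := (n - m) * (δ / n) with hr
    have hsr : s + r = n * (δ / n) := by rw [hs, hr]; ring
    have hmn : (m : ℝ) < n := by exact_mod_cast hlt
    have hs0 : 0 ≤ s := by positivity
    have hrpos : 0 < r := mul_pos (sub_pos.2 hmn) hstep
    have hrδ : r ∈ Ioc 0 δ := ⟨hrpos, by linarith⟩
    have ht0 : t 0 = 0 := by simp [ht]
    have htD : ∀ (i : Fin (m + 1)) (ω : CadPath d), ω.toFun (t i) - ω.toFun (t 0) = D i ω :=
      fun i ω => by rw [ht0]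
    have hZ : AEMeasurable (fun (ω : CadPath d) (i : Fin (m + 1)) =>
        ω.toFun (t i) - ω.toFun (t 0)) μ := by
      refine aemeasurable_pi_lambda _ fun i => ?_
      simp only [htD]
      have := hD i
      rwa [min_eq_left (by omega)] at this
    have hmain := S.setLIntegral_increment_le hg hg0 hg1 hs0 hrpos.le
      (fun ν hν => hmeas r hrδ s hs0 ν hν) (t := t) (fun i => by positivity)
      (fun i => by
        have : ((i : ℕ) : ℝ) ≤ m := by exact_mod_cast Nat.lt_succ_iff.1 i.2
        simp only [ht, hs]
        gcongr) hμ hZ hB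
    have hgm : AEMeasurable (fun ω : CadPath d =>
        ENNReal.ofReal (g (ω.toFun (s + r) - ω.toFun s))) μ := by
      obtain ⟨K, hK⟩ := hg.1
      exact (hK.continuous.measurable.comp_aemeasurable
        (hmeas r hrδ s hs0 μ hμ)).ennreal_ofReal
    set A := (fun (ω : CadPath d) (i : Fin (m + 1)) => ω.toFun (t i) - ω.toFun (t 0)) ⁻¹' B
      with hA
    have hAae : (fun ω (i : Fin (m + 1)) => D' i ω) ⁻¹' B =ᵐ[μ] A := by
      filter_upwards [hae] with ω hω
      have : (fun (i : Fin (m + 1)) => ω.toFun (t i) - ω.toFun (t 0)) =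
          fun (i : Fin (m + 1)) => D' i ω :=
        funext fun i => by rw [htD, hω i (by omega)]
      change ((fun (i : Fin (m + 1)) => D' i ω) ∈ B) = (_ ∈ B)
      rw [← this]
    calc _ ≤ μ ({ω | 1 ≤ ENNReal.ofReal (g (ω.toFun (s + r) - ω.toFun s))} ∩ A) := by
          refine measure_mono_ae ?_
          filter_upwards [hae, hAae] with ω hω hωA
          rintro ⟨h1, h2⟩
          refine ⟨?_, hωA.mp h1⟩
          have h3 : η / 2 ≤ ‖D n ω - D m ω‖ := by
            rw [hω n le_rfl, hω m hm]
            exact h2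
          have h4 : D n ω - D m ω = ω.toFun (s + r) - ω.toFun s := by
            rw [hsr]
            simp [hDdef, hs]
          rw [h4] at h3
          change 1 ≤ ENNReal.ofReal (g (ω.toFun (s + r) - ω.toFun s))
          rw [hgη _ h3, ENNReal.ofReal_one]
      _ ≤ μ.restrict A {ω | 1 ≤ ENNReal.ofReal (g (ω.toFun (s + r) - ω.toFun s))} :=
          Measure.le_restrict_apply _ _
      _ ≤ ∫⁻ ω in A, ENNReal.ofReal (g (ω.toFun (s + r) - ω.toFun s)) ∂μ := by
          have := mul_meas_ge_le_lintegral₀ (hgm.restrict (s := A)) 1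
          rwa [one_mul] at this
      _ ≤ ENNReal.ofReal ε * μ A :=
          hmain.trans (mul_le_mul_left (ENNReal.ofReal_le_ofReal (hε r hrδ)) _)
      _ = _ := by rw [measure_congr hAae]

/-- Near a point charged by a Lévy measure, jumps do occur with positive probability. -/
theorem exists_not_ae_jump_notMem {z : Rd d} {ρ : ℝ} (hρ : 0 < ρ) (hz : 4 * ρ ≤ ‖z‖)
    {u : LKparam d} (hu : u ∈ S.U) (hpos : 0 < u.1 (Metric.ball z ρ)) {T : ℝ} (hT : 0 < T) :
    ∃ μ ∈ S.P, ¬ ∀ᵐ ω ∂μ, ∀ t ∈ Ioc 0 T,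
      CadPath.jump ω t ∉ Metric.closedBall z (2 * ρ) := by
  let f₁ : ContDiffBump z := ⟨ρ, 2 * ρ, hρ, by linarith⟩
  let f₂ : ContDiffBump z := ⟨ρ / 2, ρ, by linarith, by linarith⟩
  let f₀ : ContDiffBump (0 : Rd d) := ⟨ρ / 8, ρ / 4, by linarith, by linarith⟩
  have hfar : ∀ x : Rd d, ‖x‖ < ρ → 2 * ρ ≤ dist x z := by
    intro x hx
    have := norm_sub_norm_le z x
    rw [dist_eq_norm, norm_sub_rev]
    linarith
  have hf₁0 : f₁ 0 = 0 := f₁.zero_of_le_dist (hfar 0 (by simpa using hρ))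
  have hf₂0 : f₂ =ᶠ[𝓝 0] 0 := by
    filter_upwards [Metric.ball_mem_nhds (0 : Rd d) hρ] with x hx
    rw [mem_ball_zero_iff] at hx
    exact f₂.zero_of_le_dist (le_trans (show ρ ≤ 2 * ρ by linarith) (hfar x hx))
  have hf₂00 : f₂ 0 = 0 := hf₂0.eq_of_nhds
  have hqa : ∀ x, f₂ x = max 0 ((f₁ x + f₂ x) - 1) := by
    intro x
    by_cases hx : x ∈ Metric.closedBall z ρ
    · rw [f₁.one_of_mem_closedBall hx, add_sub_cancel_left, max_eq_right f₂.nonneg]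
    · rw [Metric.mem_closedBall, not_le] at hx
      rw [f₂.zero_of_le_dist (show f₂.rOut ≤ dist x z from hx.le), add_zero,
        max_eq_left (sub_nonpos.2 f₁.le_one)]
  have hval : 0 < LKval f₂ u := by
    rw [LKval_eq_integral hf₂0]
    obtain ⟨⟨K, hK⟩, -⟩ := f₂.bddLip
    rw [integral_pos_iff_support_of_nonneg (fun x => f₂.nonneg)
      (integrable_of_lipschitzWith (S.lintegral_norm_ne_top hu) hK hf₂00), f₂.support_eq]
    exact hpos
  have hgen : 0 < LKgen S.U f₂ := hval.trans_le (S.LKval_le_LKgen f₂.bddLip hf₂00 hu)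
  have hmeas := S.eventually_aemeasurable_increment (f₁.contDiff.add f₂.contDiff)
    (f₁.bddLip.add f₂.bddLip) (by rw [hf₁0, hf₂00, add_zero])
    (fun x => add_nonneg f₁.nonneg f₂.nonneg) f₂.contDiff f₂.bddLip hqa hu hval
  set g : Rd d → ℝ := fun x => 1 + -1 * f₀ x with hg
  have hgl : BddLip g := (BddLip.const 1).add ((BddLip.const (-1)).mul f₀.bddLip)
  have hgc : ContDiff ℝ 3 g := contDiff_const.add (contDiff_const.mul f₀.contDiff)
  have hg00 : g 0 = 0 := by
    have : f₀ 0 = 1 := f₀.one_of_mem_closedBall (Metric.mem_closedBall_self f₀.rIn_pos.le)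
    simp [hg, this]
  have hg0 : ∀ x, 0 ≤ g x := fun x => by linarith [f₀.le_one (x := x), hg]
  have hg1 : ∀ x, g x ≤ 1 := fun x => by linarith [f₀.nonneg (x := x), hg]
  have hgη : ∀ x : Rd d, ρ / 2 / 2 ≤ ‖x‖ → g x = 1 := by
    intro x hx
    have : f₀ x = 0 := f₀.zero_of_le_dist (by
      rw [dist_zero_right]
      exact le_trans (show ρ / 4 ≤ ρ / 2 / 2 by linarith) hx)
    simp [hg, this]
  set C := max (LKgen S.U g + 1) 1 with hC
  have hC1 : 1 ≤ C := le_max_right _ _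
  set c := LKgen S.U f₂ / 2 with hc
  have hcpos : 0 < c := by positivity
  obtain ⟨r₀, hr₀, hsub⟩ := mem_nhdsGT_iff_exists_Ioc_subset.1 (hmeas.and
    ((S.eventually_slE_lt_mul hgc hgl hg00
      ((lt_add_one _).trans_le (le_max_left _ _) : LKgen S.U g < C)).and
    (S.eventually_mul_lt_slE f₂.contDiff f₂.bddLip hf₂00 (half_lt_self hgen : c < _))))
  rw [mem_Ioi] at hr₀
  set δ := min (min r₀ T) (c / (8 * C ^ 2)) with hδ
  have hC2 : 0 < 8 * C ^ 2 := by positivity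
  have hδpos : 0 < δ := lt_min (lt_min hr₀ hT) (by positivity)
  have hδr : δ ≤ r₀ := (min_le_left _ _).trans (min_le_left _ _)
  have hδT : δ ≤ T := (min_le_left _ _).trans (min_le_right _ _)
  have hδC : 4 * (C * δ) ^ 2 < c * δ := by
    have h1 : δ * (8 * C ^ 2) ≤ c := (le_div_iff₀ hC2).1 (min_le_right _ _)
    nlinarith [mul_pos hcpos hδpos]
  obtain ⟨-, -, hδE⟩ := hsub ⟨hδpos, hδr⟩
  rw [← S.slE_increment f₂.bddLip le_rfl hδpos.le] at hδE
  simp only [zero_add] at hδE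
  obtain ⟨μ, hμ, hlt⟩ := exists_lt_integral_of_lt_slE S.nonempty_P hδE
  refine ⟨μ, hμ, fun hae => ?_⟩
  have := S.prob μ hμ
  set W : Set (CadPath d) := {ω | ω.toFun δ - ω.toFun 0 ∈ Metric.ball z ρ} with hW
  have hWlow : ENNReal.ofReal (c * δ) ≤ μ W := by
    have hi : Integrable (fun ω : CadPath d => f₂ (ω.toFun δ - ω.toFun 0)) μ := by
      by_contra hni
      rw [integral_undef hni] at hlt
      exact absurd hlt (not_lt.2 (by positivity))
    calc ENNReal.ofReal (c * δ)
        ≤ ENNReal.ofReal (∫ ω : CadPath d, f₂ (ω.toFun δ - ω.toFun 0) ∂μ) :=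
          ENNReal.ofReal_le_ofReal hlt.le
      _ = ∫⁻ ω : CadPath d, ENNReal.ofReal (f₂ (ω.toFun δ - ω.toFun 0)) ∂μ :=
          ofReal_integral_eq_lintegral_ofReal hi (ae_of_all _ fun ω => f₂.nonneg)
      _ ≤ ∫⁻ ω, W.indicator (fun _ => 1) ω ∂μ := by
          refine lintegral_mono fun ω => ?_
          by_cases hω : ω ∈ W
          · rw [indicator_of_mem hω]
            exact ENNReal.ofReal_le_one.2 f₂.le_one
          · rw [indicator_of_notMem hω, f₂.zero_of_le_dist (not_lt.1 hω), ENNReal.ofReal_zero]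
      _ ≤ μ W := (lintegral_indicator_const_le W 1).trans_eq (one_mul _)
  set Two : ℕ → Set (CadPath d) := fun n => {ω | ∃ i ≤ n, ω ∈ firstExit
      (fun (j : ℕ) (ω : CadPath d) => ω.toFun (j * (δ / n)) - ω.toFun 0) (ρ / 2) 0 i ∧
      ∃ k, i ≤ k ∧ k ≤ n ∧ ρ / 2 ≤
        ‖(ω.toFun (k * (δ / n)) - ω.toFun 0) - (ω.toFun (i * (δ / n)) - ω.toFun 0)‖} with hTwo
  have hTwole : ∀ n, 0 < n → μ (Two n) ≤ 4 * ENNReal.ofReal (C * δ) ^ 2 := by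
    intro n hn
    refine S.measure_two_exits_le hgl hg0 hg1 (by positivity) hgη hδpos
      (fun r hr => (hsub ⟨hr.1, hr.2.trans hδr⟩).1) (fun r hr => ?_) hμ hn
    refine (hsub ⟨hr.1, hr.2.trans hδr⟩).2.1.le.trans ?_
    gcongr
    exact hr.2
  have hWsub : ∀ᵐ ω ∂μ, ω ∈ W → ω ∈ ⋃ N : ℕ, ⋂ n > N, Two n := by
    filter_upwards [hae] with ω hω hωW
    have h0 : (0 : Rd d) ∉ Metric.closedBall z (2 * ρ) := by
      rw [Metric.mem_closedBall, dist_zero_left]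
      linarith
    obtain ⟨N, hN⟩ := eventually_atTop.1 (ω.eventually_increments_notMem hδpos
      Metric.isClosed_closedBall h0 fun t ht => hω t ⟨ht.1, ht.2.trans hδT⟩)
    refine mem_iUnion.2 ⟨N, mem_iInter₂.2 fun n hn => ?_⟩
    have hn0 : (n : ℝ) ≠ 0 := Nat.cast_ne_zero.2 (Nat.ne_of_gt (Nat.zero_lt_of_lt hn))
    refine exists_two_exits (by positivity) (by linarith) hz (by simp) ?_ fun j hj => ?_
    · rw [mul_div_cancel₀ _ hn0]
      exact hωW
    · rw [sub_sub_sub_cancel_right]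
      exact hN n (le_of_lt hn) j hj
  have hmono : Monotone fun N : ℕ => ⋂ n > N, Two n := fun N M hNM =>
    biInter_subset_biInter_left fun n hn => lt_of_le_of_lt hNM hn
  have hWup : μ W ≤ 4 * ENNReal.ofReal (C * δ) ^ 2 := by
    have hW : μ W ≤ μ (⋃ N : ℕ, ⋂ n > N, Two n) := measure_mono_ae hWsub
    refine hW.trans ?_
    rw [hmono.measure_iUnion]
    exact iSup_le fun N => (measure_mono (biInter_subset_of_mem (Nat.lt_succ_self N))).trans
      (hTwole _ N.succ_pos)
  have hfin := hWlow.trans hWup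
  rw [← ENNReal.ofReal_pow (by positivity), ← ENNReal.ofReal_ofNat 4,
    ← ENNReal.ofReal_mul (by norm_num), ENNReal.ofReal_le_ofReal_iff (by positivity)] at hfin
  exact absurd hfin (not_le.2 hδC)

theorem not_processQC {φ : Rd d → ℝ} (hφc : Continuous φ)
    (hsupp : ∃ r : ℝ, 0 < r ∧ ∀ z : Rd d, ‖z‖ < r → φ z = 0)
    (hcap : 0 < capV S.V {z : Rd d | φ z ≠ 0}) {I : Set ℝ} {T : ℝ} (hT : 0 < T)
    (hI : Icc 0 T ⊆ I) :
    ¬ ProcessQC S.P I (fun t ω => poissonInt {z : Rd d | z ≠ 0} φ t ω) := by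
  intro hqc
  obtain ⟨r, hr, hφr⟩ := hsupp
  have hφ0 : φ 0 = 0 := hφr 0 (by simpa using hr)
  obtain ⟨v, ⟨p, Q, hu⟩, hv⟩ : ∃ v ∈ S.V, v {z | φ z ≠ 0} ≠ 0 := by
    by_contra! h
    refine hcap.ne' ?_
    simp only [capV, ENNReal.iSup_eq_zero]
    exact h
  obtain ⟨z, hz, hznhds⟩ := exists_mem_forall_mem_nhdsWithin_pos_measure hv
  obtain ⟨ε, hε, hball⟩ := Metric.isOpen_iff.1 (isOpen_ne_fun hφc continuous_const) z hz
  have hzε : ε ≤ ‖z‖ := by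
    by_contra! h
    exact hball (show (0 : Rd d) ∈ Metric.ball z ε by rwa [Metric.mem_ball, dist_zero_left]) hφ0
  obtain ⟨μ, hμ, hnot⟩ := S.exists_not_ae_jump_notMem (z := z) (ρ := ε / 4) (by positivity)
    (by linarith) hu (hznhds _ (mem_nhdsWithin_of_mem_nhds (Metric.ball_mem_nhds z (by positivity))))
    hT
  refine hnot (ae_iff.2 (le_antisymm (le_of_forall_pos_le_add fun a ha => ?_) zero_le))
  obtain ⟨O, -, hO, hcont⟩ := hqc a ha
  rw [zero_add]
  refine le_trans (le_trans (measure_mono fun ω hω => ?_) (le_iSup₂ (f := fun μ _ => μ O) μ hμ))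
    hO.le
  by_contra hωO
  refine hω fun t ht htK => ?_
  have hline : ContinuousOn (fun t => poissonInt {z : Rd d | z ≠ 0} φ t ω) (Icc 0 T) :=
    hcont.comp (by fun_prop : ContinuousOn (fun t : ℝ => (t, ω)) (Icc 0 T))
      fun t ht => ⟨hI ht, hωO⟩
  exact hball (Metric.closedBall_subset_ball (by linarith) htK)
    (ω.jump_eq_zero_of_continuousOn hr hφr hline t ht)

end Setting

/-- Poisson integrals are never quasi-continuous as processes.
Let `φ ∈ C_b(ℝ^d_0)` have support bounded away from `0` and of positive `𝒱`-capacity.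
Then the process `t ↦ ∫_{ℝ^d_0} φ(z) L(t,dz)` is not quasi-continuous as a process,
neither on `ℝ₊` nor on any interval `[0,T]` with `T > 0`. -/
theorem statement_13 {d : ℕ} [TopologicalSpace (CadPath d)] [MeasurableSpace (CadPath d)]
    [BorelSpace (CadPath d)] (S : Setting d) (h1 : Ass1 S.V)
    (φ : Rd d → ℝ) (hφc : Continuous φ) (hφb : ∃ C, ∀ z, |φ z| ≤ C)
    (hsupp : ∃ r : ℝ, 0 < r ∧ ∀ z : Rd d, ‖z‖ < r → φ z = 0)
    (hcap : 0 < capV S.V {z : Rd d | φ z ≠ 0}) :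
    ¬ ProcessQC S.P (Ici (0:ℝ))
        (fun t ω => poissonInt {z : Rd d | z ≠ 0} φ t ω) ∧
    ∀ T : ℝ, 0 < T →
      ¬ ProcessQC S.P (Icc (0:ℝ) T)
          (fun t ω => poissonInt {z : Rd d | z ≠ 0} φ t ω) :=
  ⟨S.not_processQC hφc hsupp hcap one_pos Icc_subset_Ici_self,
    fun _ hT => S.not_processQC hφc hsupp hcap hT subset_rfl⟩
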